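/- arXiv:0907.4885 — 4 statements merged into one kernel-verified Lean document; each statement's English description precedes it below -/
import Mathlib

section
/- Let A(x) = 1 + \sum_{u=c}^{d} A_u x^u, where 1 \le c \le d, be a real polynomial satisfying A_c > 0 and A_u \ge 0 for all c < u \le d, and let 0 < \xi < d be rational. Suppose z > 0 is a positive real number satisfying z A'(z)/A(z) = \xi. Then the limit, taken over positive integers \ell for which \xi\ell is an integer and the coefficient of x^{\xi\ell} in (A(x))^{\ell} is positive, satisfies lim_{\ell \to \infty} (1/\ell) \log Coeff[(A(x))^{\ell}, x^{\xi\ell}] = \log( A(z) / z^{\xi} ), where Coeff[p(x), x^c] denotes the coefficient of x^c in the polynomial p(x) and \log denotes the natural logarithm. -/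
/-- The polynomial `A(x) = 1 + ∑_{u=c}^{d} A_u x^u`. -/
noncomputable def polyA (c d : ℕ) (A : ℕ → ℝ) : Polynomial ℝ :=
  1 + ∑ u ∈ Finset.Icc c d, Polynomial.C (A u) * Polynomial.X ^ u

open Polynomial


lemma nn_mul {P Q : ℝ[X]} (hP : ∀ i, 0 ≤ P.coeff i) (hQ : ∀ i, 0 ≤ Q.coeff i) :
    ∀ i, 0 ≤ (P * Q).coeff i := by
  intro i
  rw [coeff_mul]
  exact Finset.sum_nonneg fun x _ => mul_nonneg (hP _) (hQ _)

lemma nn_pow {P : ℝ[X]} (hP : ∀ i, 0 ≤ P.coeff i) (n : ℕ) : ∀ i, 0 ≤ (P ^ n).coeff i := by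
  induction n with
  | zero => intro i; rw [pow_zero, coeff_one]; split_ifs <;> norm_num
  | succ n ih => rw [pow_succ]; exact nn_mul ih hP

lemma csup_mul {P Q : ℝ[X]} (hP : ∀ i, 0 ≤ P.coeff i) (hQ : ∀ i, 0 ≤ Q.coeff i) (i j : ℕ) :
    P.coeff i * Q.coeff j ≤ (P * Q).coeff (i + j) := by
  rw [coeff_mul]
  exact Finset.single_le_sum (f := fun x : ℕ × ℕ => P.coeff x.1 * Q.coeff x.2)
    (fun x _ => mul_nonneg (hP _) (hQ _)) (a := (i, j)) (by simp)

lemma csup_pow {P : ℝ[X]} (hP : ∀ i, 0 ≤ P.coeff i) (i n : ℕ) :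
    P.coeff i ^ n ≤ (P ^ n).coeff (n * i) := by
  induction n with
  | zero => simp
  | succ n ih =>
    rw [pow_succ, pow_succ, add_mul, one_mul]
    exact (mul_le_mul_of_nonneg_right ih (hP _)).trans (csup_mul (nn_pow hP n) hP _ _)

lemma coeff_theta (P : ℝ[X]) (k : ℕ) : (X * derivative P).coeff k = k * P.coeff k := by
  cases k with
  | zero => simp
  | succ k => rw [coeff_X_mul, coeff_derivative]; push_cast; ring

lemma sum_coeff (P : ℝ[X]) {n : ℕ} (h : P.natDegree < n) :
    P.eval 1 = ∑ k ∈ Finset.range n, P.coeff k := by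
  rw [eval_eq_sum_range' h]; simp

lemma sum_one (P : ℝ[X]) {n : ℕ} (h : P.natDegree < n) :
    (derivative P).eval 1 = ∑ k ∈ Finset.range n, (k : ℝ) * P.coeff k := by
  have h2 : (X * derivative P).natDegree < n := by
    refine lt_of_le_of_lt ?_ h
    rw [natDegree_le_iff_coeff_eq_zero]
    intro N hN
    rw [coeff_theta, coeff_eq_zero_of_natDegree_lt hN, mul_zero]
  have := sum_coeff _ h2
  simpa [coeff_theta] using this

lemma sum_two (P : ℝ[X]) {n : ℕ} (h : P.natDegree < n) :
    (derivative (X * derivative P)).eval 1 = ∑ k ∈ Finset.range n, (k : ℝ)^2 * P.coeff k := by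
  have h2 : (X * derivative P).natDegree < n := by
    refine lt_of_le_of_lt ?_ h
    rw [natDegree_le_iff_coeff_eq_zero]
    intro N hN
    rw [coeff_theta, coeff_eq_zero_of_natDegree_lt hN, mul_zero]
  rw [sum_one _ h2]
  refine Finset.sum_congr rfl fun k _ => ?_
  rw [coeff_theta]; ring

lemma mom (P : ℝ[X]) (r v : ℝ) (h0 : P.eval 1 = 1) (h1 : (derivative P).eval 1 = r)
    (h2 : (derivative (derivative P)).eval 1 = v) (n : ℕ) :
    (P ^ n).eval 1 = 1 ∧ (derivative (P ^ n)).eval 1 = n * r ∧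
    (derivative (derivative (P ^ n))).eval 1 = n * v + n * (n - 1) * r ^ 2 := by
  induction n with
  | zero => simp
  | succ n ih =>
    obtain ⟨a, b, c⟩ := ih
    rw [pow_succ]
    simp only [derivative_mul, derivative_add, eval_add, eval_mul, a, b, c, h0, h1, h2]
    push_cast
    refine ⟨by ring, by ring, by ring⟩

/-- concentration -/
lemma conc (B : ℝ[X]) (hB : ∀ i, 0 ≤ B.coeff i) (r : ℝ) (h0 : B.eval 1 = 1)
    (h1 : (derivative B).eval 1 = r) (δ : ℝ) (hδ : 0 < δ) :
    ∃ L : ℕ, ∀ l ≥ L, ∃ k : ℕ, |(k:ℝ) - r * l| ≤ δ * l ∧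
      1 / (2 * ((B.natDegree : ℝ) * l + 1)) ≤ (B ^ l).coeff k := by
  obtain ⟨v, hv⟩ : ∃ v, (derivative (derivative B)).eval 1 = v := ⟨_, rfl⟩
  obtain ⟨L, hL⟩ := exists_nat_gt (2 * (v + r - r ^ 2) / δ ^ 2)
  refine ⟨L + 1, fun l hl => ?_⟩
  have hl1 : (L : ℝ) + 1 ≤ l := by exact_mod_cast hl
  have hl0 : (0 : ℝ) < l := by have : (0:ℝ) ≤ L := L.cast_nonneg
                               linarith
  obtain ⟨a, b, c⟩ := mom B r v h0 h1 hv l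
  have hdeg : (B ^ l).natDegree < B.natDegree * l + 1 := by
    have := natDegree_pow_le (p := B) (n := l)
    rw [mul_comm] at this; omega
  have e0 := sum_coeff _ hdeg
  have e1 := sum_one _ hdeg
  have e2 := sum_two _ hdeg
  simp only [derivative_mul, derivative_X, eval_add, eval_mul, eval_X, one_mul] at e2
  rw [a] at e0
  rw [b] at e1
  rw [b, c] at e2
  set K := B.natDegree * l + 1 with hK
  by_contra! hcon
  have hKr : (B.natDegree : ℝ) * l + 1 = K := by rw [hK]; push_cast; ring
  rw [hKr] at hcon
  have hKp : (0 : ℝ) < K := by rw [hK]; positivity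
  have hvar : ∑ k ∈ Finset.range K, ((k : ℝ) - r * l) ^ 2 * (B ^ l).coeff k
      = l * (v + r - r ^ 2) := by
    have : ∀ k : ℕ, ((k : ℝ) - r * l) ^ 2 * (B ^ l).coeff k =
      (k:ℝ)^2 * (B ^ l).coeff k - 2 * r * l * (k * (B ^ l).coeff k)
        + (r * l)^2 * (B ^ l).coeff k := by intro k; ring
    simp only [this, Finset.sum_add_distrib, Finset.sum_sub_distrib, ← Finset.mul_sum]
    rw [← e0, ← e1, ← e2]; ring
  have hpt : ∀ k ∈ Finset.range K, (B ^ l).coeff k ≤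
      1 / (2 * K) + (((k : ℝ) - r * l) ^ 2 * (B ^ l).coeff k) / (δ * l) ^ 2 := by
    intro k _
    have hq := nn_pow hB l k
    by_cases hk : |(k:ℝ) - r * l| ≤ δ * l
    · have := hcon k hk
      have : 0 ≤ (((k : ℝ) - r * l) ^ 2 * (B ^ l).coeff k) / (δ * l) ^ 2 := by positivity
      linarith
    · push Not at hk
      have h3 : (δ * l) ^ 2 ≤ ((k:ℝ) - r * l) ^ 2 := by
        rw [← sq_abs ((k:ℝ) - r * l)]
        gcongr
      have : (B ^ l).coeff k ≤ (((k : ℝ) - r * l) ^ 2 * (B ^ l).coeff k) / (δ * l) ^ 2 := by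
        rw [le_div_iff₀ (by positivity)]
        nlinarith
      have : (0:ℝ) ≤ 1 / (2 * K) := by positivity
      linarith
  have hs := Finset.sum_le_sum hpt
  rw [← e0, Finset.sum_add_distrib, Finset.sum_const, Finset.card_range,
    nsmul_eq_mul, ← Finset.sum_div, hvar] at hs
  have h4 : (K:ℝ) * (1 / (2 * K)) = 1 / 2 := by field_simp
  have h5 : l * (v + r - r ^ 2) / (δ * l) ^ 2 < 1 / 2 := by
    rw [div_lt_iff₀ (by positivity)] at hL ⊢
    have : 2 * (v + r - r ^ 2) < l * δ ^ 2 := by nlinarith [sq_nonneg δ]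
    nlinarith
  linarith

lemma fek (q : ℕ → ℝ) (hq : ∀ m n, q m * q n ≤ q (m + n)) (h0 : ∀ n, 0 ≤ q n)
    (h : ∀ ε > 0, ∃ m : ℕ, 0 < m ∧ Real.exp (-ε * m) ≤ q m) (ε : ℝ) (hε : 0 < ε) :
    ∃ J : ℕ, ∀ j ≥ J, 0 < q j → -ε * j ≤ Real.log (q j) := by
  classical
  obtain ⟨m, hm, hqm⟩ := h (ε / 2) (by positivity)
  have hpow : ∀ t n : ℕ, q t * q m ^ n ≤ q (t + n * m) := by
    intro t n
    induction n with
    | zero => simp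
    | succ n ih =>
      calc q t * q m ^ (n+1) = (q t * q m ^ n) * q m := by ring
        _ ≤ q (t + n * m) * q m := mul_le_mul_of_nonneg_right ih (h0 _)
        _ ≤ q (t + n * m + m) := hq _ _
        _ = _ := by congr 1; ring
  -- constant
  have hC : ∀ ρ : ℕ, ∃ C : ℝ, ∀ j, j % m = ρ → 0 < q j → C - ε / 2 * j ≤ Real.log (q j) := by
    intro ρ
    by_cases hex : ∃ t, t % m = ρ ∧ 0 < q t
    · obtain ⟨t1, t2⟩ := Nat.find_spec hex
      set t := Nat.find hex
      refine ⟨Real.log (q t), fun j hj hqj => ?_⟩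
      have htj : t ≤ j := Nat.find_min' hex ⟨hj, hqj⟩
      have hd : m ∣ j - t := (Nat.modEq_iff_dvd' htj).1 (by rw [Nat.ModEq, t1, hj])
      obtain ⟨n, hn⟩ := hd
      have hjt : j = t + n * m := by rw [mul_comm n m]; omega
      have hqm0 : 0 < q m := lt_of_lt_of_le (Real.exp_pos _) hqm
      have h1 : Real.log (q t * q m ^ n) ≤ Real.log (q j) := by
        rw [hjt]; exact Real.log_le_log (by positivity) (hpow t n)
      rw [Real.log_mul t2.ne' (by positivity), Real.log_pow] at h1
      have h2 : -(ε/2) * m ≤ Real.log (q m) := (Real.le_log_iff_exp_le hqm0).2 hqm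
      have h3 : (n:ℝ) * (-(ε/2) * m) ≤ n * Real.log (q m) := by gcongr
      have h4 : (j:ℝ) = t + n * m := by rw [hjt]; push_cast; ring
      have h5 : (0:ℝ) ≤ t := t.cast_nonneg
      rw [h4]; nlinarith
    · exact ⟨0, fun j hj hqj => absurd ⟨j, hj, hqj⟩ hex⟩
  choose C hC using hC
  obtain ⟨J, hJ⟩ := exists_nat_gt ((∑ ρ ∈ Finset.range m, |C ρ|) / (ε / 2))
  refine ⟨J, fun j hj hqj => ?_⟩
  have h1 := hC (j % m) j rfl hqj
  have h2 : |C (j % m)| ≤ ∑ ρ ∈ Finset.range m, |C ρ| :=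
    Finset.single_le_sum (f := fun ρ => |C ρ|) (fun _ _ => abs_nonneg _)
      (Finset.mem_range.2 (Nat.mod_lt _ hm))
  rw [div_lt_iff₀ (by positivity)] at hJ
  have h3 : (J:ℝ) ≤ j := by exact_mod_cast hj
  have h4 := neg_abs_le (C (j % m))
  nlinarith

lemma logbd (D : ℝ) (hD : 0 ≤ D) (N : ℝ) (ε : ℝ) (hε : 0 < ε) :
    ∃ L : ℕ, ∀ l : ℕ, l ≥ L → N * Real.log (2 * (D * l + 1)) ≤ ε * l := by
  have h : (fun x : ℝ => Real.log x) =o[Filter.atTop] (fun x => x) := Real.isLittleO_log_id_atTop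
  have ht : Filter.Tendsto (fun l : ℕ => 2 * ((D + 1) * (l:ℝ) + 1)) Filter.atTop Filter.atTop := by
    refine Filter.Tendsto.const_mul_atTop (by norm_num) ?_
    refine Filter.tendsto_atTop_add_const_right _ _ ?_
    exact Filter.Tendsto.const_mul_atTop (by positivity) tendsto_natCast_atTop_atTop
  have h2 := h.comp_tendsto ht
  have hc : 0 < ε / ((|N| + 1) * (2 * (D + 2))) := by positivity
  have h3 := h2.bound hc
  obtain ⟨L, hL⟩ := Filter.eventually_atTop.1 h3
  refine ⟨L + 1, fun l hl => ?_⟩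
  have h4 := hL l (by omega)
  have hl1 : (1:ℝ) ≤ l := by exact_mod_cast (by omega : 1 ≤ l)
  simp only [Function.comp, Real.norm_eq_abs] at h4
  have hp : (1:ℝ) ≤ 2 * (D * l + 1) := by nlinarith
  have h5 : Real.log (2 * (D * l + 1)) ≤ Real.log (2 * ((D+1) * l + 1)) :=
    Real.log_le_log (by linarith) (by nlinarith)
  have h6 := Real.log_nonneg hp
  rw [abs_of_nonneg (h6.trans h5), abs_of_pos (a := 2 * ((D + 1) * (l:ℝ) + 1) ) (by positivity)] at h4
  calc N * Real.log (2 * (D * l + 1)) ≤ (|N| + 1) * Real.log (2 * (D * l + 1)) := by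
        gcongr; linarith [le_abs_self N]
    _ ≤ (|N| + 1) * (ε / ((|N| + 1) * (2 * (D + 2))) * (2 * ((D + 2) * l))) := by
        gcongr
        refine (h5.trans h4).trans ?_
        gcongr
        linarith
    _ = ε * l := by field_simp

lemma key (B : ℝ[X]) (hB : ∀ i, 0 ≤ B.coeff i) (r : ℕ) (hr : 0 < r) (h0 : B.eval 1 = 1)
    (h1 : (derivative B).eval 1 = r) (hb : 0 < B.coeff 0) (ε : ℝ) (hε : 0 < ε) :
    ∃ J : ℕ, ∀ j ≥ J, 0 < (B ^ j).coeff (j * r) → -ε * j ≤ Real.log ((B ^ j).coeff (j * r)) := by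
  refine fek (fun j => (B ^ j).coeff (j * r)) ?_ (fun n => nn_pow hB n _) ?_ ε hε
  · intro m n
    rw [pow_add, add_mul]
    exact csup_mul (nn_pow hB _) (nn_pow hB _) _ _
  clear hε ε
  intro ε hε
  obtain ⟨u, hur, hu⟩ : ∃ u, r < u ∧ 0 < B.coeff u := by
    by_contra! hcon
    have e0 := sum_coeff B (Nat.lt_succ_self _)
    have e1 := sum_one B (Nat.lt_succ_self _)
    have : ∑ k ∈ Finset.range (B.natDegree + 1), ((r:ℝ) - k) * B.coeff k = 0 := by
      simp only [sub_mul, Finset.sum_sub_distrib, ← Finset.mul_sum]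
      rw [← e0, ← e1, h0, h1]; ring
    have hle := Finset.single_le_sum (s := Finset.range (B.natDegree + 1))
      (f := fun k : ℕ => ((r:ℝ) - k) * B.coeff k) (a := 0) (by
        intro k _
        by_cases hk : r < k
        · have := le_antisymm (hcon k hk) (hB k)
          simp [this]
        · have : (k:ℝ) ≤ r := by exact_mod_cast not_lt.1 hk
          exact mul_nonneg (by linarith) (hB k)) (by simp)
    rw [this] at hle
    have : (0:ℝ) < r * B.coeff 0 := by positivity
    simp at hle; linarith
  set β := min (min (B.coeff 0) (B.coeff u)) 1 with hβ
  have hβ0 : 0 < β := by simp [hβ, hb, hu]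
  have hβ1 : β ≤ 1 := min_le_right _ _
  have hβb : β ≤ B.coeff 0 := (min_le_left _ _).trans (min_le_left _ _)
  have hβu : β ≤ B.coeff u := (min_le_left _ _).trans (min_le_right _ _)
  have hlβ : Real.log β ≤ 0 := Real.log_nonpos hβ0.le hβ1
  set δ := ε / 2 / (1 - Real.log β) with hδ
  have hδ0 : 0 < δ := div_pos (by positivity) (by linarith)
  obtain ⟨L1, hL1⟩ := conc B hB r h0 h1 δ hδ0
  obtain ⟨L2, hL2⟩ := logbd B.natDegree (by positivity) u (ε / 2) (by positivity)
  obtain ⟨l, hl1, hl2, hl3⟩ : ∃ l, L1 ≤ l ∧ L2 ≤ l ∧ 0 < l := ⟨L1 + L2 + 1, by omega, by omega, by omega⟩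
  obtain ⟨k, hk, hq⟩ := hL1 l hl1
  have hL := hL2 l hl2
  set M : ℝ := 2 * ((B.natDegree : ℝ) * l + 1) with hM
  have hM1 : 1 ≤ M := by
    have : (0:ℝ) ≤ (B.natDegree : ℝ) * l := by positivity
    rw [hM]; linarith
  -- common step
  have fin : ∀ N a w : ℕ, 0 < N → N ≤ u → (a : ℝ) ≤ δ * l → β ≤ B.coeff w →
      N * k + a * w = (l * N + a) * r →
      ∃ m : ℕ, 0 < m ∧ Real.exp (-ε * m) ≤ (B ^ m).coeff (m * r) := by
    intro N a w hN hNu ha hw he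
    refine ⟨l * N + a, by positivity, ?_⟩
    rw [← he, pow_add, pow_mul]
    have hx : (1 / M) ^ N * β ^ a ≤ (((B ^ l) ^ N) * B ^ a).coeff (N * k + a * w) := by
      refine le_trans ?_ (csup_mul (nn_pow (nn_pow hB l) N) (nn_pow hB a) _ _)
      refine mul_le_mul ?_ ?_ (by positivity) (nn_pow (nn_pow hB l) N _)
      · exact (pow_le_pow_left₀ (by positivity) hq N).trans (csup_pow (nn_pow hB l) k N)
      · exact (pow_le_pow_left₀ hβ0.le hw a).trans (csup_pow hB w a)
    refine le_trans ?_ hx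
    rw [← Real.le_log_iff_exp_le (by positivity), Real.log_mul (by positivity) (by positivity),
      Real.log_pow, Real.log_pow, one_div, Real.log_inv]
    have hlM := Real.log_nonneg hM1
    have y1 : (N:ℝ) * Real.log M ≤ u * Real.log M := by gcongr
    have y2 : (a:ℝ) * (1 - Real.log β) ≤ ε / 2 * l := by
      calc (a:ℝ) * (1 - Real.log β) ≤ δ * l * (1 - Real.log β) := by
            apply mul_le_mul_of_nonneg_right ha; linarith
        _ = ε / 2 * l := by
            have : 1 - Real.log β ≠ 0 := by linarith
            rw [hδ]; field_simp
    have y3 : (l:ℝ) ≤ ((l * N + a : ℕ) : ℝ) := by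
      have : l ≤ l * N + a := by nlinarith
      exact_mod_cast this
    have y4 : (0:ℝ) ≤ a := a.cast_nonneg
    nlinarith
  rcases le_total (r * l) k with hc | hc
  · obtain ⟨a, rfl⟩ := Nat.exists_eq_add_of_le hc
    refine fin r a 0 hr hur.le ?_ hβb (by ring)
    refine le_trans (le_trans ?_ (le_abs_self _)) hk
    push_cast; linarith
  · obtain ⟨a, ha⟩ := Nat.exists_eq_add_of_le hc
    obtain ⟨N, rfl⟩ := Nat.exists_eq_add_of_lt hur
    refine fin (N + 1) a (r + N + 1) (by omega) (by omega) ?_ hβu ?_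
    · refine le_trans (le_trans ?_ (neg_le_abs _)) hk
      have : (r:ℝ) * l = k + a := by exact_mod_cast ha
      rw [this]; linarith
    · calc (N+1) * k + a * (r + N + 1) = (N+1) * (k + a) + a * r := by ring
        _ = _ := by rw [← ha]; ring

lemma polyA_coeff (c d : ℕ) (A : ℕ → ℝ) (k : ℕ) : (polyA c d A).coeff k =
    (if k = 0 then 1 else 0) + if k ∈ Finset.Icc c d then A k else 0 := by
  unfold polyA
  rw [coeff_add, coeff_one, finsetSum_coeff]
  simp only [coeff_C_mul_X_pow, Finset.sum_ite_eq]

/-- Hayman-type formula for the exponential growth rate of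
`Coeff[(A(x))^ℓ, x^{ξℓ}]` (a special case of Di et al., Corollary 16). -/
theorem stmt0 (c d : ℕ) (hc : 1 ≤ c) (hcd : c ≤ d) (A : ℕ → ℝ)
    (hAc : 0 < A c) (hA : ∀ u, c < u → u ≤ d → 0 ≤ A u)
    (ξ : ℚ) (hξ0 : 0 < ξ) (hξd : (ξ : ℝ) < d)
    (z : ℝ) (hz : 0 < z)
    (hzeq : z * (Polynomial.derivative (polyA c d A)).eval z
        / (polyA c d A).eval z = (ξ : ℝ)) :
    Filter.Tendsto
      (fun ℓ : ℕ => (1 / (ℓ : ℝ)) *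
        Real.log (((polyA c d A) ^ ℓ).coeff ((ξ * (ℓ : ℚ)).num.toNat)))
      (Filter.atTop ⊓ Filter.principal
        {ℓ : ℕ | 0 < ℓ ∧ (ξ * (ℓ : ℚ)).den = 1 ∧
          0 < ((polyA c d A) ^ ℓ).coeff ((ξ * (ℓ : ℚ)).num.toNat)})
      (nhds (Real.log ((polyA c d A).eval z / z ^ (ξ : ℝ)))) := by
  set Q := polyA c d A with hQ
  have hQ0 : 1 ≤ Q.coeff 0 := by
    rw [hQ, polyA_coeff, if_pos rfl, if_neg (by rw [Finset.mem_Icc]; omega), add_zero]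
  have hQn : ∀ i, 0 ≤ Q.coeff i := by
    intro i
    rw [hQ, polyA_coeff]
    have h1 : (0:ℝ) ≤ if i = 0 then 1 else 0 := by split_ifs <;> norm_num
    have h2 : 0 ≤ if i ∈ Finset.Icc c d then A i else 0 := by
      split_ifs with h
      · rw [Finset.mem_Icc] at h
        rcases h.1.eq_or_lt with h3 | h3
        · rw [← h3]; exact hAc.le
        · exact hA i h3 h.2
      · exact le_rfl
    linarith
  have hQz : 0 < Q.eval z := by
    rw [eval_eq_sum_range]
    have := Finset.single_le_sum (s := Finset.range (Q.natDegree + 1))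
      (f := fun i => Q.coeff i * z ^ i) (a := 0)
      (fun i _ => mul_nonneg (hQn i) (by positivity)) (by simp)
    simp only [pow_zero, mul_one] at this
    linarith
  set a := Q.eval z with ha
  set B : ℝ[X] := C a⁻¹ * Q.comp (C z * X) with hB
  have hBc : ∀ l k, (B ^ l).coeff k = (a ^ l)⁻¹ * ((Q ^ l).coeff k * z ^ k) := by
    intro l k
    rw [hB, mul_pow, ← C_pow, coeff_C_mul, ← pow_comp, comp_C_mul_X_coeff, inv_pow]
  have hBn : ∀ i, 0 ≤ B.coeff i := by
    intro i
    have := hBc 1 i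
    rw [pow_one, pow_one, pow_one] at this
    rw [this]
    have := hQn i
    positivity
  have hB0 : 0 < B.coeff 0 := by
    have := hBc 1 0
    rw [pow_one, pow_one, pow_one] at this
    rw [this]
    have : 0 < Q.coeff 0 := by linarith
    positivity
  have hBe : B.eval 1 = 1 := by
    simp [hB, ← ha, hQz.ne']
  have hBd : (derivative B).eval 1 = (ξ : ℝ) := by
    rw [← hzeq, hB]
    simp [derivative_comp]
    field_simp
  set s := ξ.den with hs
  have hs0 : 0 < s := ξ.den_pos
  obtain ⟨r, hr⟩ : ∃ r : ℕ, ξ.num = r := ⟨ξ.num.toNat, by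
    have := Rat.num_pos.2 hξ0; omega⟩
  have hr0 : 0 < r := by have := Rat.num_pos.2 hξ0; omega
  have hsr : ξ * s = r := by
    have := Rat.mul_den_eq_num ξ
    rw [hr] at this; exact_mod_cast this
  have hsrR : (ξ:ℝ) * s = r := by exact_mod_cast hsr
  obtain ⟨m0, m1, -⟩ := mom B ξ _ hBe hBd rfl s
  rw [mul_comm, hsrR] at m1
  have hPn := nn_pow hBn s
  have hP0 : 0 < (B ^ s).coeff 0 := by
    rw [coeff_zero_eq_eval_zero, eval_pow, ← coeff_zero_eq_eval_zero]; positivity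
  rw [Metric.tendsto_nhds]
  intro ε hε
  obtain ⟨J, hJ⟩ := key (B ^ s) hPn r hr0 m0 m1 hP0 (ε / 2) (by positivity)
  rw [Filter.eventually_inf_principal]
  filter_upwards [Filter.eventually_ge_atTop (s * J)] with l hl hmem
  obtain ⟨hl0, hden, hpos⟩ := hmem
  have hdvd : s ∣ l := by
    have h1 : ξ * l = ((ξ * l).num : ℚ) := by
      conv_lhs => rw [← Rat.num_div_den (ξ * l), hden]
      simp
    have h2 : (r : ℤ) * l = (ξ * l).num * s := by
      have : (r : ℚ) * l = (ξ * l).num * s := by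
        rw [← h1, ← hsr]; ring
      exact_mod_cast this
    have h3 : (s : ℤ) ∣ (r : ℤ) * l := ⟨_, by rw [h2]; ring⟩
    have h4 : s ∣ r * l := by exact_mod_cast h3
    have h5 : Nat.Coprime s r := by
      have := ξ.reduced
      rw [hr] at this
      exact this.symm
    exact h5.dvd_of_dvd_mul_left h4
  obtain ⟨j, rfl⟩ := hdvd
  have hnum : (ξ * ((s * j : ℕ) : ℚ)).num.toNat = j * r := by
    have : ξ * ((s * j : ℕ) : ℚ) = ((j * r : ℕ) : ℚ) := by
      push_cast; rw [← hsr]; ring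
    rw [this, Rat.num_natCast, Int.toNat_natCast]
  rw [hnum] at hpos ⊢
  have hjJ : J ≤ j := Nat.le_of_mul_le_mul_left hl hs0
  have hq := hBc (s * j) (j * r)
  rw [pow_mul B] at hq
  have hqpos : 0 < ((B ^ s) ^ j).coeff (j * r) := by rw [hq]; positivity
  have hlow := hJ j hjJ hqpos
  have hup : ((B ^ s) ^ j).coeff (j * r) ≤ 1 := by
    have h1 : ((B ^ s) ^ j).eval 1 = 1 := by rw [eval_pow, m0, one_pow]
    rw [← h1, sum_coeff ((B ^ s) ^ j) (n := ((B ^ s) ^ j).natDegree + (j * r) + 1) (by omega)]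
    exact Finset.single_le_sum (f := fun k => ((B ^ s) ^ j).coeff k)
      (fun k _ => nn_pow hPn j k) (by rw [Finset.mem_range]; omega)
  have hlog := Real.log_nonpos hqpos.le hup
  have hql : Real.log (((B ^ s) ^ j).coeff (j * r)) =
      Real.log ((Q ^ (s * j)).coeff (j * r)) + (j * r : ℕ) * Real.log z
        - (s * j : ℕ) * Real.log a := by
    rw [hq, Real.log_mul (by positivity) (by positivity), Real.log_inv, Real.log_pow,
      Real.log_mul hpos.ne' (by positivity), Real.log_pow]
    ring
  have hlr : (0:ℝ) < ((s * j : ℕ) : ℝ) := by exact_mod_cast hl0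
  have hjl : (j:ℝ) ≤ ((s * j : ℕ) : ℝ) := by
    exact_mod_cast Nat.le_mul_of_pos_left j hs0
  have hjr : ((j * r : ℕ) : ℝ) = ξ * ((s * j : ℕ) : ℝ) := by
    push_cast; rw [← hsrR]; ring
  rw [hjr] at hql
  rw [Real.dist_eq, Real.log_div hQz.ne' (by positivity), Real.log_rpow hz]
  have hfin : 1 / ((s * j : ℕ) : ℝ) * Real.log ((Q ^ (s * j)).coeff (j * r))
      - (Real.log a - ξ * Real.log z) =
      Real.log (((B ^ s) ^ j).coeff (j * r)) / ((s * j : ℕ) : ℝ) := by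
    rw [hql, eq_div_iff hlr.ne', sub_mul, mul_right_comm, one_div, inv_mul_cancel₀ hlr.ne']
    ring
  rw [hfin, abs_div, abs_of_pos hlr, abs_of_nonpos hlog, div_lt_iff₀ hlr]
  nlinarith
end

section
/- Let B(x,y) = 1 + \sum_{u=1}^{k} \sum_{v=c}^{d} B_{u,v} x^u y^v, where k \ge 1 and 1 \le c \le d, be a real bivariate polynomial satisfying B_{u,v} \ge 0 for all 1 \le u \le k, c \le v \le d, and let \xi, \theta > 0 be rational. Suppose x_0 > 0 and y_0 > 0 are positive real numbers satisfying the pair of simultaneous equations x_0 (\partial B/\partial x)(x_0,y_0)/B(x_0,y_0) = \xi and y_0 (\partial B/\partial y)(x_0,y_0)/B(x_0,y_0) = \theta. Then the limit, taken over positive integers \ell for which \xi\ell and \theta\ell are integers and the coefficient of x^{\xi\ell} y^{\theta\ell} in (B(x,y))^{\ell} is positive, satisfies lim_{\ell \to \infty} (1/\ell) \log Coeff[(B(x,y))^{\ell}, x^{\xi\ell} y^{\theta\ell}] = \log( B(x_0,y_0) / (x_0^{\xi} y_0^{\theta}) ), where Coeff[p(x,y), x^c y^d] denotes the coefficient of x^c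 y^d in the bivariate polynomial p(x,y) and \log denotes the natural logarithm. -/
/-- The bivariate polynomial `B(x,y) = 1 + ∑_{u=1}^{k} ∑_{v=c}^{d} B_{u,v} x^u y^v`,
where variable `0` plays the role of `x` and variable `1` the role of `y`. -/
noncomputable def polyB (k c d : ℕ) (B : ℕ → ℕ → ℝ) : MvPolynomial (Fin 2) ℝ :=
  1 + ∑ u ∈ Finset.Icc 1 k, ∑ v ∈ Finset.Icc c d,
    MvPolynomial.C (B u v) * MvPolynomial.X (0 : Fin 2) ^ u *
      MvPolynomial.X (1 : Fin 2) ^ v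

open Filter in
theorem fekete_aux (L : Set ℕ) (f : ℕ → ℝ) (lam : ℝ)
    (hadd : ∀ a ∈ L, ∀ b ∈ L, a + b ∈ L ∧ f a + f b ≤ f (a + b))
    (hup : ∀ a ∈ L, f a ≤ lam * a)
    (hlow : ∀ ε : ℝ, 0 < ε → ∃ m ∈ L, 0 < m ∧ (lam - ε) * m ≤ f m) :
    Tendsto (fun l : ℕ => (1 / (l : ℝ)) * f l) (atTop ⊓ 𝓟 L) (nhds lam) := by
  classical
  rw [Metric.tendsto_nhds]
  intro ε hε
  obtain ⟨m, hmL, hm, hfm⟩ := hlow (ε / 2) (by positivity)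
  have hrep : ∀ r : ℕ, ∃ C : ℝ, 0 ≤ C ∧ ∀ l ∈ L, l % m = r → (lam - ε/2) * l - C ≤ f l := by
    intro r
    by_cases h : ∃ l, l ∈ L ∧ l % m = r
    · have hs := Nat.find_spec h
      set q := Nat.find h with hq
      refine ⟨|lam - ε/2| * q + |f q|, by positivity, ?_⟩
      intro l hl hlr
      have hle : q ≤ l := Nat.find_min' h ⟨hl, hlr⟩
      have hdvd : m ∣ l - q := (Nat.modEq_iff_dvd' hle).1 (by rw [Nat.ModEq, hs.2, hlr])
      obtain ⟨j, hj⟩ := hdvd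
      have hl' : l = q + m * j := by omega
      have key : ∀ j : ℕ, q + m * j ∈ L ∧ f q + j * f m ≤ f (q + m * j) := by
        intro j
        induction j with
        | zero => simpa using hs.1
        | succ j ih =>
          have := hadd _ ih.1 _ hmL
          rw [show q + m * (j+1) = q + m * j + m by ring]
          refine ⟨this.1, ?_⟩
          push_cast
          linarith [ih.2, this.2]
      have h1 := (key j).2
      rw [hl']
      push_cast
      have h2 : (j:ℝ) * ((lam - ε/2) * m) ≤ j * f m := by gcongr
      have h3 := neg_abs_le (f q)
      have h4 : (lam - ε/2) * q ≤ |lam - ε/2| * q := by gcongr; exact le_abs_self _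
      nlinarith
    · exact ⟨0, le_rfl, fun l hl hr => absurd ⟨l, hl, hr⟩ h⟩
  choose C hC0 hC using hrep
  set K := ∑ r ∈ Finset.range m, C r with hK
  have hK0 : 0 ≤ K := Finset.sum_nonneg fun i _ => hC0 i
  have hall : ∀ l ∈ L, (lam - ε/2) * l - K ≤ f l := by
    intro l hl
    have h1 := hC _ l hl rfl
    have h2 : C (l % m) ≤ K := Finset.single_le_sum (f := C) (fun i _ => hC0 i)
      (Finset.mem_range.2 (Nat.mod_lt _ hm))
    linarith
  rw [eventually_inf_principal]
  obtain ⟨N, hN⟩ := exists_nat_gt (K / (ε/2))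
  filter_upwards [eventually_ge_atTop (N+1)] with l hl hlL
  have hl0 : (0:ℝ) < l := by exact_mod_cast (by omega : 0 < l)
  have hNl : (N:ℝ) < l := by exact_mod_cast (by omega : N < l)
  have h1 := hall l hlL
  have h2 := hup l hlL
  have h3 : K < l * (ε/2) := by
    rw [div_lt_iff₀ (by positivity)] at hN
    nlinarith
  rw [Real.dist_eq, abs_lt]
  have e : (1 / (l:ℝ)) * f l - lam = (f l - lam * l) / l := by field_simp
  rw [e]
  constructor
  · rw [lt_div_iff₀ hl0]; nlinarith
  · rw [div_lt_iff₀ hl0]; nlinarith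

theorem dirichlet_aux {ι : Type*} (S : Finset ι) (v : ι → ℝ) (ε : ℝ) (hε : 0 < ε) :
    ∃ k : ℕ, 0 < k ∧ ∃ n : ι → ℤ, ∀ s ∈ S, |n s - k * v s| < ε := by
  classical
  obtain ⟨Q, hQ⟩ := exists_nat_gt (1/ε)
  have hQ0 : (0:ℝ) < Q := lt_trans (by positivity) hQ
  have hQn : 0 < Q := by exact_mod_cast hQ0
  let F : ℕ → (S → Fin Q) := fun k s => ⟨⌊Q * Int.fract (k * v s)⌋₊, by
    rw [Nat.floor_lt (by have := Int.fract_nonneg (k * v s); positivity)]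
    have := Int.fract_lt_one (k * v s)
    nlinarith⟩
  have main : ∀ a b : ℕ, a < b → F a = F b →
      ∃ k : ℕ, 0 < k ∧ ∃ n : ι → ℤ, ∀ s ∈ S, |n s - k * v s| < ε := by
    intro a b hab hF
    refine ⟨b - a, by omega, fun s => ⌊b * v s⌋ - ⌊a * v s⌋, fun s hs => ?_⟩
    have h := congrArg Fin.val (congrFun hF ⟨s, hs⟩)
    simp only [F] at h
    have ha := Int.fract_nonneg (a * v s)
    have hb := Int.fract_nonneg (b * v s)
    have a1 := Nat.floor_le (a := Q * Int.fract (a * v s)) (by positivity)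
    have a2 := Nat.lt_floor_add_one (Q * Int.fract (a * v s))
    have b1 := Nat.floor_le (a := Q * Int.fract (b * v s)) (by positivity)
    have b2 := Nat.lt_floor_add_one (Q * Int.fract (b * v s))
    rw [h] at a1 a2
    have e1 := Int.floor_add_fract (a * v s)
    have e2 := Int.floor_add_fract (b * v s)
    rw [Nat.cast_sub hab.le]
    push_cast
    have e : (⌊b * v s⌋:ℝ) - ⌊a * v s⌋ - (b - a) * v s
      = Int.fract (a * v s) - Int.fract (b * v s) := by linarith
    rw [e]
    have h1 : 1 < Q * ε := by rwa [div_lt_iff₀ hε] at hQ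
    rw [abs_lt]
    constructor <;> by_contra! hh <;> nlinarith
  obtain ⟨a, b, hab, hF⟩ := Finite.exists_ne_map_eq_of_infinite F
  rcases lt_or_gt_of_ne hab with h | h
  · exact main a b h hF
  · exact main b a h hF.symm

theorem log_fact_upper (n : ℕ) (hn : 1 ≤ n) :
    Real.log (n.factorial) ≤ n * Real.log n - n + Real.log n + 1 := by
  induction n, hn using Nat.le_induction with
  | base => simp
  | succ n hn ih =>
    have hn0 : (0:ℝ) < n := by exact_mod_cast hn
    rw [Nat.factorial_succ, Nat.cast_mul, Real.log_mul (by positivity) (by positivity)]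
    have h := Real.one_sub_inv_le_log_of_pos (x := ((n+1:ℕ):ℝ)/n) (by positivity)
    rw [Real.log_div (by positivity) (by positivity)] at h
    have h2 : (n+1:ℝ) * (1 - (((n+1:ℕ):ℝ)/n)⁻¹) = 1 := by push_cast; field_simp; ring
    have h3 := mul_le_mul_of_nonneg_left h (by positivity : (0:ℝ) ≤ n+1)
    rw [h2] at h3
    push_cast at *
    nlinarith

theorem log_fact_lower (n : ℕ) (hn : 1 ≤ n) :
    n * Real.log n - n ≤ Real.log (n.factorial) := by
  have hn0 : (0:ℝ) < n := by exact_mod_cast hn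
  have h := Real.pow_div_factorial_le_exp (n:ℝ) hn0.le n
  have h2 := Real.log_le_log (by positivity) h
  rw [Real.log_exp, Real.log_div (by positivity) (by positivity), Real.log_pow] at h2
  linarith

theorem log_fact_term (n m : ℕ) (p : ℝ) (hp : 0 < p) (hnm : n ≤ m) (hm : 1 ≤ m)
    (h : |(n:ℝ) - m * p| ≤ 1) :
    Real.log (n.factorial) ≤
      n * Real.log m + n * Real.log p - n + Real.log m + 1 + 1 / p := by
  have hm0 : (0:ℝ) < m := by exact_mod_cast hm
  have hlm : 0 ≤ Real.log m := Real.log_nonneg (by exact_mod_cast hm)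
  rcases Nat.eq_zero_or_pos n with rfl | hn
  · have : 0 < p⁻¹ := by positivity
    simp; linarith
  have hn0 : (0:ℝ) < n := by exact_mod_cast hn
  have h1 := log_fact_upper n hn
  have h2 : Real.log n ≤ Real.log m := Real.log_le_log hn0 (by exact_mod_cast hnm)
  have h3 := Real.log_le_sub_one_of_pos (x := n / (m * p)) (by positivity)
  rw [Real.log_div (by positivity) (by positivity), Real.log_mul (by positivity) (by positivity)] at h3
  have h4 : (n:ℝ) * (n / (m * p) - 1) ≤ 1 / p := by
    have e : (n:ℝ) * (n / (m * p) - 1) = (n / m) * (n - m * p) * (1 / p) := by field_simp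
    rw [e]
    have : (n:ℝ)/m ≤ 1 := by rw [div_le_one hm0]; exact_mod_cast hnm
    have h5 := (abs_le.1 h).2
    have h6 : (n:ℝ)/m * (n - m*p) ≤ 1 := by
      have : 0 < (n:ℝ)/m := by positivity
      nlinarith
    have : 0 < 1 / p := by positivity
    nlinarith
  have h5 := mul_le_mul_of_nonneg_left h3 hn0.le
  nlinarith

theorem log_multinomial_lower {ι : Type*} (S : Finset ι) (p : ι → ℝ) (hp : ∀ s ∈ S, 0 < p s)
    (n : ι → ℕ) (m : ℕ) (hm : 1 ≤ m) (hnm : ∑ s ∈ S, n s = m)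
    (h : ∀ s ∈ S, |(n s:ℝ) - m * p s| ≤ 1) :
    -(S.card * (Real.log m + 1) + ∑ s ∈ S, 1 / p s) ≤
      Real.log (Nat.multinomial S n) + ∑ s ∈ S, n s * Real.log (p s) := by
  have hs := Nat.multinomial_spec S n
  rw [hnm] at hs
  have hs' : (∏ i ∈ S, ((n i).factorial:ℝ)) * (Nat.multinomial S n : ℝ) = m.factorial := by
    exact_mod_cast hs
  have hl := congrArg Real.log hs'
  have hpos : (0:ℝ) < Nat.multinomial S n := by exact_mod_cast Nat.multinomial_pos S n
  rw [Real.log_mul (Finset.prod_ne_zero_iff.2 fun i _ => by positivity) hpos.ne',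
    Real.log_prod (fun i _ => by positivity)] at hl
  have hlow := log_fact_lower m hm
  have hsum : ∑ s ∈ S, Real.log ((n s).factorial) ≤ ∑ s ∈ S, (n s * Real.log m +
      n s * Real.log (p s) - n s + Real.log m + 1 + 1 / p s) :=
    Finset.sum_le_sum fun s hs => log_fact_term _ _ _ (hp s hs)
      (hnm ▸ Finset.single_le_sum (f := n) (fun _ _ => Nat.zero_le _) hs) hm (h s hs)
  have hc : ∑ s ∈ S, (n s : ℝ) = m := by exact_mod_cast hnm
  simp only [Finset.sum_add_distrib, Finset.sum_sub_distrib, ← Finset.sum_mul, hc,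
    Finset.sum_const, nsmul_eq_mul, mul_one] at hsum
  linarith

section Aux

open MvPolynomial

theorem coeff_pow_nonneg' {σ : Type*} (P : MvPolynomial σ ℝ) (hP : ∀ s, 0 ≤ coeff s P) (n : ℕ) :
    ∀ s, 0 ≤ coeff s (P ^ n) := by
  classical
  induction n with
  | zero => intro s; rw [pow_zero, coeff_one]; split_ifs <;> simp
  | succ n ih =>
    intro s
    rw [pow_succ, coeff_mul]
    exact Finset.sum_nonneg fun x _ => mul_nonneg (ih _) (hP _)

theorem coeff_pow_add_ge {σ : Type*} (P : MvPolynomial σ ℝ) (hP : ∀ s, 0 ≤ coeff s P) (a b : ℕ)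
    (s t : σ →₀ ℕ) : coeff s (P ^ a) * coeff t (P ^ b) ≤ coeff (s + t) (P ^ (a + b)) := by
  classical
  rw [pow_add, coeff_mul]
  exact Finset.single_le_sum (f := fun x : (σ →₀ ℕ) × (σ →₀ ℕ) => coeff x.1 (P ^ a) * coeff x.2 (P ^ b))
    (fun x _ => mul_nonneg (coeff_pow_nonneg' P hP _ _) (coeff_pow_nonneg' P hP _ _))
    (a := (s, t)) (by simp)

theorem coeff_pow_multinomial {σ : Type*} (P : MvPolynomial σ ℝ) (hP : ∀ s, 0 ≤ coeff s P) (m : ℕ)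
    (n : (σ →₀ ℕ) → ℕ) (hn : ∑ s ∈ P.support, n s = m) (hn0 : ∀ s ∉ P.support, n s = 0) :
    (Nat.multinomial P.support n : ℝ) * ∏ s ∈ P.support, coeff s P ^ n s ≤
      coeff (∑ s ∈ P.support, n s • s) (P ^ m) := by
  classical
  have e : P ^ m = ∑ k ∈ P.support.piAntidiag m, monomial (∑ s ∈ P.support, k s • s)
      ((Nat.multinomial P.support k : ℝ) * ∏ s ∈ P.support, coeff s P ^ k s) := by
    conv_lhs => rw [P.as_sum, Finset.sum_pow_eq_sum_piAntidiag]
    refine Finset.sum_congr rfl fun k _ => ?_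
    simp_rw [monomial_pow]
    rw [← monomial_sum_prod, ← C_mul_monomial]
    simp
  rw [e, coeff_sum]
  refine le_trans (le_of_eq ?_) (Finset.single_le_sum (f := fun k => coeff (∑ s ∈ P.support, n s • s)
    (monomial (∑ s ∈ P.support, k s • s)
      ((Nat.multinomial P.support k : ℝ) * ∏ s ∈ P.support, coeff s P ^ k s))) ?_ (a := n) ?_)
  · simp
  · intro k _
    rw [coeff_monomial]
    split_ifs
    · exact mul_nonneg (Nat.cast_nonneg _) (Finset.prod_nonneg fun s _ => pow_nonneg (hP _) _)
    · exact le_rfl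
  · rw [Finset.mem_piAntidiag]
    refine ⟨hn, fun i hi => ?_⟩
    by_contra h
    exact hi (hn0 i h)

theorem eval_X_mul_pderiv (P : MvPolynomial (Fin 2) ℝ) (z : Fin 2 → ℝ) (i : Fin 2) :
    z i * eval z (pderiv i P) =
      ∑ s ∈ P.support, coeff s P * (z 0 ^ s 0 * z 1 ^ s 1) * s i := by
  have : z i * eval z (pderiv i P) = eval z (X i * pderiv i P) := by simp
  rw [this]
  conv_lhs => rw [P.as_sum, map_sum, Finset.mul_sum, map_sum]
  refine Finset.sum_congr rfl fun s _ => ?_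
  rw [X_mul_pderiv_monomial]
  simp [eval_monomial, Finsupp.prod_fintype]
  ring

theorem eval_eq_two (P : MvPolynomial (Fin 2) ℝ) (z : Fin 2 → ℝ) :
    eval z P = ∑ s ∈ P.support, coeff s P * (z 0 ^ s 0 * z 1 ^ s 1) := by
  rw [eval_eq']; simp

theorem coeff_mul_le_eval (P : MvPolynomial (Fin 2) ℝ) (hP : ∀ s, 0 ≤ coeff s P) (z : Fin 2 → ℝ)
    (hz : ∀ i, 0 < z i) (t : Fin 2 →₀ ℕ) : coeff t P * (z 0 ^ t 0 * z 1 ^ t 1) ≤ eval z P := by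
  have hz0 := hz 0
  have hz1 := hz 1
  have hnn : ∀ s ∈ P.support, 0 ≤ coeff s P * (z 0 ^ s 0 * z 1 ^ s 1) := fun s _ =>
    mul_nonneg (hP s) (by positivity)
  rw [eval_eq_two]
  by_cases h : t ∈ P.support
  · exact Finset.single_le_sum (f := fun s => coeff s P * (z 0 ^ s 0 * z 1 ^ s 1)) hnn h
  · rw [notMem_support_iff.1 h, zero_mul]
    exact Finset.sum_nonneg hnn

theorem int_match {ι : Type*} (S : Finset ι) (p : ι → ℝ) (N : ι → ℕ) (w : ι → ℕ) (m a : ℕ) (W : ℝ)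
    (hW : ∑ s ∈ S, (w s : ℝ) ≤ W) (h : ∀ s ∈ S, |(N s : ℝ) - m * p s| < 1 / (1 + W))
    (ha : (m : ℝ) * ∑ s ∈ S, p s * w s = a) : ∑ s ∈ S, N s * w s = a := by
  have hW0 : 0 ≤ W := le_trans (Finset.sum_nonneg fun _ _ => Nat.cast_nonneg _) hW
  have h1 : |((∑ s ∈ S, N s * w s : ℕ) : ℝ) - a| < 1 := by
    rw [← ha, Finset.mul_sum]
    push_cast
    rw [← Finset.sum_sub_distrib]
    calc |∑ s ∈ S, ((N s : ℝ) * w s - m * (p s * w s))|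
        ≤ ∑ s ∈ S, |(N s : ℝ) * w s - m * (p s * w s)| := Finset.abs_sum_le_sum_abs _ _
      _ ≤ ∑ s ∈ S, 1 / (1 + W) * (w s : ℝ) := by
          refine Finset.sum_le_sum fun s hs => ?_
          rw [show (N s : ℝ) * w s - m * (p s * w s) = (N s - m * p s) * w s by ring, abs_mul,
            Nat.abs_cast]
          exact mul_le_mul_of_nonneg_right (h s hs).le (Nat.cast_nonneg _)
      _ = 1 / (1 + W) * ∑ s ∈ S, (w s : ℝ) := by rw [Finset.mul_sum]
      _ ≤ 1 / (1 + W) * W := by gcongr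
      _ < 1 := by
          rw [one_div, inv_mul_eq_div, div_lt_one (by positivity)]; linarith
  have h2 : |((∑ s ∈ S, N s * w s : ℕ) : ℤ) - (a : ℤ)| < 1 := by exact_mod_cast h1
  rw [Int.abs_lt_one_iff] at h2
  omega

theorem rat_int (ξ : ℚ) (hξ : 0 < ξ) (m : ℕ) (h : ξ.den ∣ m) : ∃ a : ℕ, (a : ℝ) = ξ * m := by
  obtain ⟨j, rfl⟩ := h
  refine ⟨ξ.num.toNat * j, ?_⟩
  have h1 : ((ξ.num.toNat : ℤ)) = ξ.num := Int.toNat_of_nonneg (Rat.num_pos.2 hξ).le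
  have h2 : ((ξ.num.toNat : ℝ)) = ξ.num := by exact_mod_cast h1
  have h3 : (ξ : ℝ) * ξ.den = ξ.num := by exact_mod_cast Rat.mul_den_eq_num ξ
  push_cast
  rw [h2, ← h3]; ring

theorem low_aux (P : MvPolynomial (Fin 2) ℝ) (hP : ∀ s, 0 ≤ coeff s P) (z : Fin 2 → ℝ)
    (hz : ∀ i, 0 < z i) (hE : 0 < eval z P) (ξ θ : ℚ) (hξ : 0 < ξ) (hθ : 0 < θ)
    (h0 : z 0 * eval z (pderiv 0 P) / eval z P = (ξ : ℝ))
    (h1 : z 1 * eval z (pderiv 1 P) / eval z P = (θ : ℝ)) :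
    ∃ K1 K2 : ℝ, ∀ M : ℕ, ∃ m : ℕ, M ≤ m ∧ 0 < m ∧ ∃ t : Fin 2 →₀ ℕ, (t 0 : ℝ) = ξ * m ∧
      (t 1 : ℝ) = θ * m ∧ 0 < coeff t (P ^ m) ∧
      m * (Real.log (eval z P) - ξ * Real.log (z 0) - θ * Real.log (z 1)) -
        (K1 * (Real.log m + 1) + K2) ≤ Real.log (coeff t (P ^ m)) := by
  classical
  have hz0 := hz 0
  have hz1 := hz 1
  set S := P.support with hS
  set E := eval z P with hEdef
  have hcpos : ∀ s ∈ S, 0 < coeff s P := fun s hs =>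
    lt_of_le_of_ne (hP s) (Ne.symm (mem_support_iff.1 hs))
  let p : (Fin 2 →₀ ℕ) → ℝ := fun s => coeff s P * (z 0 ^ s 0 * z 1 ^ s 1) / E
  have hp : ∀ s ∈ S, 0 < p s := fun s hs => by
    have := hcpos s hs
    positivity
  have hp1 : ∑ s ∈ S, p s = 1 := by
    simp only [p]
    rw [← Finset.sum_div, ← eval_eq_two, div_self hE.ne']
  have hpx : ∑ s ∈ S, p s * (s 0 : ℕ) = ξ := by
    rw [← h0, eval_X_mul_pderiv, Finset.sum_div]
    exact Finset.sum_congr rfl fun s _ => by simp only [p]; ring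
  have hpy : ∑ s ∈ S, p s * (s 1 : ℕ) = θ := by
    rw [← h1, eval_X_mul_pderiv, Finset.sum_div]
    exact Finset.sum_congr rfl fun s _ => by simp only [p]; ring
  refine ⟨S.card, ∑ s ∈ S, 1 / p s, fun M => ?_⟩
  set W : ℝ := ∑ s ∈ S, ((1:ℝ) + (s 0 : ℕ) + (s 1 : ℕ)) with hW
  have hW0 : 0 ≤ W := Finset.sum_nonneg fun s _ => by positivity
  have hε1 : 1 / (1 + W) ≤ 1 := by rw [div_le_one (by positivity)]; linarith
  obtain ⟨k, hk, n, hn⟩ := dirichlet_aux S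
    (fun s => ((ξ.den * θ.den * (M + 1) : ℕ) : ℝ) * p s) (1 / (1 + W)) (by positivity)
  set m := k * (ξ.den * θ.den * (M + 1)) with hm
  have hdpos : 0 < ξ.den * θ.den := Nat.mul_pos ξ.den_pos θ.den_pos
  have hmpos : 0 < m := Nat.mul_pos hk (Nat.mul_pos hdpos (by omega))
  have hMm : M ≤ m := by
    have := Nat.le_mul_of_pos_left (M+1) (Nat.mul_pos hk hdpos)
    rw [hm, ← mul_assoc]; omega
  let N : (Fin 2 →₀ ℕ) → ℕ := fun s => if s ∈ S then (n s).toNat else 0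
  have hN : ∀ s ∈ S, |(N s : ℝ) - m * p s| < 1 / (1 + W) := by
    intro s hs
    have h := hn s hs
    have e : (k:ℝ) * (((ξ.den * θ.den * (M + 1) : ℕ) : ℝ) * p s) = m * p s := by
      rw [hm, Nat.cast_mul k]; ring
    rw [e] at h
    have hmp : 0 < (m:ℝ) * p s := mul_pos (by exact_mod_cast hmpos) (hp s hs)
    have hn1 : (-1:ℝ) < n s := by linarith [(abs_lt.1 h).1]
    have hn2 : (-1:ℤ) < n s := by exact_mod_cast hn1
    have hn3 : (((n s).toNat : ℤ)) = n s := Int.toNat_of_nonneg (by omega)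
    have hn4 : (((n s).toNat : ℝ)) = n s := by exact_mod_cast hn3
    simp only [N, if_pos hs]
    rwa [hn4]
  obtain ⟨a, ha⟩ := rat_int ξ hξ m ⟨k * (θ.den * (M+1)), by rw [hm]; ring⟩
  obtain ⟨b, hb⟩ := rat_int θ hθ m ⟨k * (ξ.den * (M+1)), by rw [hm]; ring⟩
  have m0 : ∑ s ∈ S, N s * 1 = m := int_match S p N (fun _ => 1) m m W
    (Finset.sum_le_sum fun s _ => by push_cast; nlinarith [(s 0).cast_nonneg (α := ℝ), (s 1).cast_nonneg (α := ℝ)]) hN (by simp [hp1])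
  have ma : ∑ s ∈ S, N s * s 0 = a := int_match S p N (fun s => s 0) m a W
    (Finset.sum_le_sum fun s _ => by nlinarith [(s 1).cast_nonneg (α := ℝ)]) hN
    (by rw [hpx, ha]; ring)
  have mb : ∑ s ∈ S, N s * s 1 = b := int_match S p N (fun s => s 1) m b W
    (Finset.sum_le_sum fun s _ => by nlinarith [(s 0).cast_nonneg (α := ℝ)]) hN
    (by rw [hpy, hb]; ring)
  simp only [mul_one] at m0
  have hco := coeff_pow_multinomial P hP m N m0 (fun s hs => by simp only [N]; exact if_neg hs)
  have hlm := log_multinomial_lower S p hp N m hmpos m0 (fun s hs => ((hN s hs).trans_le hε1).le)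
  have hmul : (0:ℝ) < Nat.multinomial S N := by exact_mod_cast Nat.multinomial_pos S N
  have hprod : 0 < ∏ s ∈ S, coeff s P ^ N s := Finset.prod_pos fun s hs => pow_pos (hcpos s hs) _
  have hpos := lt_of_lt_of_le (mul_pos hmul hprod) hco
  refine ⟨m, hMm, hmpos, ∑ s ∈ S, N s • s, ?_, ?_, hpos, ?_⟩
  · rw [← ha, ← ma]; simp [Finsupp.finsetSum_apply]
  · rw [← hb, ← mb]; simp [Finsupp.finsetSum_apply]
  · have hl := Real.log_le_log (mul_pos hmul hprod) hco
    rw [Real.log_mul hmul.ne' hprod.ne', Real.log_prod (fun s hs => (pow_pos (hcpos s hs) _).ne')] at hl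
    refine le_trans ?_ hl
    have e : ∑ s ∈ S, Real.log (coeff s P ^ N s) = ∑ s ∈ S, (N s : ℝ) * Real.log (p s) +
        m * (Real.log E - ξ * Real.log (z 0) - θ * Real.log (z 1)) := by
      have e1 : ∀ s ∈ S, Real.log (coeff s P ^ N s) = (N s : ℝ) * Real.log (p s) +
          N s * Real.log E - (N s * (s 0 : ℕ) : ℕ) * Real.log (z 0)
            - (N s * (s 1 : ℕ) : ℕ) * Real.log (z 1) := by
        intro s hs
        simp only [p]
        have := hcpos s hs
        rw [Real.log_pow, Real.log_div (by positivity) hE.ne', Real.log_mul this.ne' (by positivity),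
          Real.log_mul (by positivity) (by positivity), Real.log_pow, Real.log_pow]
        push_cast
        ring
      rw [Finset.sum_congr rfl e1]
      simp only [Finset.sum_add_distrib, Finset.sum_sub_distrib, ← Finset.sum_mul]
      rw [← Nat.cast_sum, ← Nat.cast_sum, ← Nat.cast_sum, m0, ma, mb, ha, hb]
      ring
    rw [e]
    linarith

theorem num_toNat_iff (ξ : ℚ) (hξ : 0 < ξ) (l : ℕ) :
    (ξ * (l : ℚ)).den = 1 ↔ (((ξ * (l : ℚ)).num.toNat : ℕ) : ℝ) = ξ * l := by
  have hnn : 0 ≤ ξ * (l : ℚ) := by positivity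
  have h1 : (((ξ * (l : ℚ)).num.toNat : ℕ) : ℤ) = (ξ * (l : ℚ)).num :=
    Int.toNat_of_nonneg (Rat.num_nonneg.2 hnn)
  have h2 : (((ξ * (l : ℚ)).num.toNat : ℕ) : ℚ) = (ξ * (l : ℚ)).num := by exact_mod_cast h1
  have h3 : ((((ξ * (l : ℚ)).num.toNat : ℕ) : ℝ) = ξ * l) ↔ ((ξ * (l : ℚ)).num : ℚ) = ξ * (l : ℚ) := by
    rw [← h2]; norm_cast
  rw [h3]
  exact (Rat.den_eq_one_iff _)

theorem num_toNat_of_eq (ξ : ℚ) (l a : ℕ) (h : (a : ℝ) = ξ * l) :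
    (ξ * (l : ℚ)).den = 1 ∧ (ξ * (l : ℚ)).num.toNat = a := by
  have : ξ * (l : ℚ) = (a : ℚ) := by exact_mod_cast h.symm
  rw [this]
  simp

open Filter in
theorem general_aux (P : MvPolynomial (Fin 2) ℝ) (hP : ∀ s, 0 ≤ coeff s P) (z : Fin 2 → ℝ)
    (hz : ∀ i, 0 < z i) (hE : 0 < eval z P) (ξ θ : ℚ) (hξ : 0 < ξ) (hθ : 0 < θ)
    (h0 : z 0 * eval z (pderiv 0 P) / eval z P = (ξ : ℝ))
    (h1 : z 1 * eval z (pderiv 1 P) / eval z P = (θ : ℝ)) (t : ℕ → Fin 2 →₀ ℕ)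
    (ht : t = fun l : ℕ => (Finsupp.single (0 : Fin 2) ((ξ * (l : ℚ)).num.toNat) +
            Finsupp.single (1 : Fin 2) ((θ * (l : ℚ)).num.toNat))) :
    Tendsto (fun l : ℕ => (1 / (l : ℝ)) * Real.log (coeff (t l) (P ^ l)))
      (atTop ⊓ 𝓟 {l : ℕ | 0 < l ∧ (ξ * (l : ℚ)).den = 1 ∧ (θ * (l : ℚ)).den = 1 ∧
        0 < coeff (t l) (P ^ l)})
      (nhds (Real.log (eval z P) - ξ * Real.log (z 0) - θ * Real.log (z 1))) := by
  have hz0 := hz 0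
  have hz1 := hz 1
  have t0 : ∀ l, t l 0 = (ξ * (l : ℚ)).num.toNat := fun l => by rw [ht]; simp
  have t1 : ∀ l, t l 1 = (θ * (l : ℚ)).num.toNat := fun l => by rw [ht]; simp
  have tuniq : ∀ (l : ℕ) (s : Fin 2 →₀ ℕ), (s 0 : ℝ) = ξ * l → (s 1 : ℝ) = θ * l →
      (ξ * (l : ℚ)).den = 1 ∧ (θ * (l : ℚ)).den = 1 ∧ t l = s := by
    intro l s hs0 hs1
    obtain ⟨a1, a2⟩ := num_toNat_of_eq ξ l _ hs0
    obtain ⟨b1, b2⟩ := num_toNat_of_eq θ l _ hs1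
    refine ⟨a1, b1, ?_⟩
    ext i
    fin_cases i
    · exact (t0 l).trans a2
    · exact (t1 l).trans b2
  apply fekete_aux
  · rintro a ⟨a0, aξ, aθ, ac⟩ b ⟨b0, bξ, bθ, bc⟩
    rw [num_toNat_iff ξ hξ, ← t0] at aξ bξ
    rw [num_toNat_iff θ hθ, ← t1] at aθ bθ
    obtain ⟨c1, c2, c3⟩ := tuniq (a + b) (t a + t b)
      (by simp only [Finsupp.add_apply]; push_cast; rw [aξ, bξ]; ring)
      (by simp only [Finsupp.add_apply]; push_cast; rw [aθ, bθ]; ring)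
    have hge := coeff_pow_add_ge P hP a b (t a) (t b)
    have hpos := lt_of_lt_of_le (mul_pos ac bc) hge
    refine ⟨⟨by omega, c1, c2, by rwa [c3]⟩, ?_⟩
    rw [c3, ← Real.log_mul ac.ne' bc.ne']
    exact Real.log_le_log (mul_pos ac bc) hge
  · rintro a ⟨a0, aξ, aθ, ac⟩
    rw [num_toNat_iff ξ hξ, ← t0] at aξ
    rw [num_toNat_iff θ hθ, ← t1] at aθ
    have h := coeff_mul_le_eval (P ^ a) (coeff_pow_nonneg' P hP a) z hz (t a)
    have h2 := Real.log_le_log (by positivity) h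
    rw [map_pow, Real.log_pow, Real.log_mul ac.ne' (by positivity),
      Real.log_mul (by positivity) (by positivity), Real.log_pow, Real.log_pow, aξ, aθ] at h2
    nlinarith
  · intro ε hε
    obtain ⟨K1, K2, hK⟩ := low_aux P hP z hz hE ξ θ hξ hθ h0 h1
    have hlim : Tendsto (fun m : ℕ => (K1 * (Real.log m + 1) + K2) / (m:ℝ)) atTop (nhds 0) := by
      have l1 : Tendsto (fun m : ℕ => Real.log m / (m:ℝ)) atTop (nhds 0) :=
        (Real.isLittleO_log_id_atTop.tendsto_div_nhds_zero).comp tendsto_natCast_atTop_atTop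
      have l2 : Tendsto (fun m : ℕ => (K1 + K2) / (m:ℝ)) atTop (nhds 0) :=
        tendsto_const_div_atTop_nhds_zero_nat _
      have := (l1.const_mul K1).add l2
      simp only [mul_zero, add_zero] at this
      refine this.congr fun m => by ring
    obtain ⟨M, hM⟩ := eventually_atTop.1 (hlim.eventually (gt_mem_nhds hε))
    obtain ⟨m, hMm, hm, s, hs0, hs1, hsc, hs⟩ := hK M
    obtain ⟨c1, c2, c3⟩ := tuniq m s hs0 hs1
    refine ⟨m, ⟨hm, c1, c2, by rwa [c3]⟩, hm, ?_⟩
    have hm' : (0:ℝ) < m := by exact_mod_cast hm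
    have h := hM m hMm
    rw [div_lt_iff₀ hm'] at h
    rw [c3]
    nlinarith

theorem polyB_nonneg (k c d : ℕ) (B : ℕ → ℕ → ℝ)
    (hB : ∀ u v, 1 ≤ u → u ≤ k → c ≤ v → v ≤ d → 0 ≤ B u v) (s : Fin 2 →₀ ℕ) :
    0 ≤ coeff s (polyB k c d B) := by
  classical
  rw [polyB, coeff_add, coeff_sum, coeff_one]
  refine add_nonneg (by split_ifs <;> simp) (Finset.sum_nonneg fun u hu => ?_)
  rw [coeff_sum]
  refine Finset.sum_nonneg fun v hv => ?_
  rw [Finset.mem_Icc] at hu hv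
  rw [mul_assoc, coeff_C_mul, X_pow_eq_monomial, X_pow_eq_monomial, monomial_mul, coeff_monomial]
  exact mul_nonneg (hB u v hu.1 hu.2 hv.1 hv.2) (by split_ifs <;> simp)

end Aux

/-- Bivariate Hayman-type formula for the exponential growth rate of
`Coeff[(B(x,y))^ℓ, x^{ξℓ} y^{θℓ}]` (a special case of Di et al., Corollary 16). -/
theorem stmt2 (k c d : ℕ) (hk : 1 ≤ k) (hc : 1 ≤ c) (hcd : c ≤ d)
    (B : ℕ → ℕ → ℝ)
    (hB : ∀ u v, 1 ≤ u → u ≤ k → c ≤ v → v ≤ d → 0 ≤ B u v)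
    (ξ θ : ℚ) (hξ : 0 < ξ) (hθ : 0 < θ)
    (x₀ y₀ : ℝ) (hx₀ : 0 < x₀) (hy₀ : 0 < y₀)
    (heqx : x₀ * MvPolynomial.eval ![x₀, y₀]
        (MvPolynomial.pderiv (0 : Fin 2) (polyB k c d B))
        / MvPolynomial.eval ![x₀, y₀] (polyB k c d B) = (ξ : ℝ))
    (heqy : y₀ * MvPolynomial.eval ![x₀, y₀]
        (MvPolynomial.pderiv (1 : Fin 2) (polyB k c d B))
        / MvPolynomial.eval ![x₀, y₀] (polyB k c d B) = (θ : ℝ)) :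
    Filter.Tendsto
      (fun ℓ : ℕ => (1 / (ℓ : ℝ)) *
        Real.log (MvPolynomial.coeff
          (Finsupp.single (0 : Fin 2) ((ξ * (ℓ : ℚ)).num.toNat) +
            Finsupp.single (1 : Fin 2) ((θ * (ℓ : ℚ)).num.toNat))
          ((polyB k c d B) ^ ℓ)))
      (Filter.atTop ⊓ Filter.principal
        {ℓ : ℕ | 0 < ℓ ∧ (ξ * (ℓ : ℚ)).den = 1 ∧ (θ * (ℓ : ℚ)).den = 1 ∧
          0 < MvPolynomial.coeff
            (Finsupp.single (0 : Fin 2) ((ξ * (ℓ : ℚ)).num.toNat) +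
              Finsupp.single (1 : Fin 2) ((θ * (ℓ : ℚ)).num.toNat))
            ((polyB k c d B) ^ ℓ)})
      (nhds (Real.log (MvPolynomial.eval ![x₀, y₀] (polyB k c d B)
        / (x₀ ^ (ξ : ℝ) * y₀ ^ (θ : ℝ))))) := by
  have hz : ∀ i, 0 < (![x₀, y₀] : Fin 2 → ℝ) i := by
    intro i; fin_cases i
    · exact hx₀
    · exact hy₀
  have hP := polyB_nonneg k c d B hB
  have hE : 0 < MvPolynomial.eval ![x₀, y₀] (polyB k c d B) := by
    refine lt_of_le_of_ne ?_ ?_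
    · refine le_trans ?_ (coeff_mul_le_eval _ hP _ hz 0)
      exact mul_nonneg (hP _) (mul_nonneg (pow_nonneg (hz 0).le _) (pow_nonneg (hz 1).le _))
    · intro h
      rw [← h, div_zero] at heqx
      have : (0:ℝ) < ξ := by exact_mod_cast hξ
      linarith
  have key := general_aux (polyB k c d B) hP ![x₀, y₀] hz hE ξ θ hξ hθ heqx heqy _ rfl
  have e : Real.log (MvPolynomial.eval ![x₀, y₀] (polyB k c d B)
        / (x₀ ^ (ξ : ℝ) * y₀ ^ (θ : ℝ))) = Real.log (MvPolynomial.eval ![x₀, y₀] (polyB k c d B))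
        - ξ * Real.log x₀ - θ * Real.log y₀ := by
    rw [Real.log_div hE.ne' (by positivity), Real.log_mul (by positivity) (by positivity),
      Real.log_rpow hx₀, Real.log_rpow hy₀]
    ring
  rw [e]
  exact key
end

section
/- Let k \ge 1 and, for each t = 1, ..., k, let A_t(x) = 1 + \sum_{u=c_t}^{d_t} A_{t,u} x^u, where 1 \le c_t \le d_t, be a real polynomial satisfying A_{t,c_t} > 0 and A_{t,u} \ge 0 for all c_t < u \le d_t. Let \gamma_1, ..., \gamma_k > 0 be rational and let \delta be rational with 0 < \delta < \sum_{t=1}^k \gamma_t d_t, and let z_0 be the unique positive real solution of \sum_{t=1}^{k} \gamma_t \, z A_t'(z)/A_t(z) = \delta. Then the limit, taken over positive integers m for which \gamma_t m (for all t) and \delta m are integers and the coefficient of x^{\delta m} in \prod_{t=1}^{k} (A_t(x))^{\gamma_t m} is positive, satisfies lim_{m \to \infty} (1/m) \log Coeff[ \prod_{t=1}^{k} (A_t(x))^{\gamma_t m}, x^{\delta m} ] = \sum_{t=1}^{k} \gamma_t \log A_t(z_0) - \delta \log z_0, where Coeff[p(x), x^c] denotes the coefficient of x^c in the polynomial p(x)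 and \log denotes the natural logarithm. -/
open Polynomial in
theorem aux_coeff_theta (P : ℝ[X]) (j : ℕ) : (X * derivative P).coeff j = j * P.coeff j := by
  cases j with
  | zero => simp
  | succ j => rw [coeff_X_mul, coeff_derivative]; push_cast; ring

open Polynomial in
theorem aux_pow_nonneg (F : ℝ[X]) (hF : ∀ i, 0 ≤ F.coeff i) (n i : ℕ) : 0 ≤ (F ^ n).coeff i := by
  induction n generalizing i with
  | zero => rw [pow_zero, coeff_one]; split_ifs <;> norm_num
  | succ n ih =>
    rw [pow_succ, coeff_mul]
    exact Finset.sum_nonneg fun x _ => mul_nonneg (ih _) (hF _)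

open Polynomial in
theorem aux_mul_coeff_ge (P Q : ℝ[X]) (hP : ∀ i, 0 ≤ P.coeff i) (hQ : ∀ i, 0 ≤ Q.coeff i) (i j : ℕ) :
    P.coeff i * Q.coeff j ≤ (P * Q).coeff (i + j) := by
  rw [coeff_mul]
  exact Finset.single_le_sum (f := fun x : ℕ × ℕ => P.coeff x.1 * Q.coeff x.2)
    (fun x _ => mul_nonneg (hP _) (hQ _)) (Finset.HasAntidiagonal.mem_antidiagonal.mpr (rfl : (i, j).1 + (i, j).2 = i + j))

open Polynomial in
theorem aux_pow_coeff_ge (F : ℝ[X]) (hF : ∀ i, 0 ≤ F.coeff i) (n m i j : ℕ) :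
    (F ^ n).coeff i * (F ^ m).coeff j ≤ (F ^ (n + m)).coeff (i + j) := by
  rw [pow_add]
  exact aux_mul_coeff_ge _ _ (aux_pow_nonneg F hF n) (aux_pow_nonneg F hF m) i j

open Polynomial in
theorem aux_pow_pos (F : ℝ[X]) (hF : ∀ i, 0 ≤ F.coeff i) {n m i j : ℕ}
    (h1 : 0 < (F ^ n).coeff i) (h2 : 0 < (F ^ m).coeff j) : 0 < (F ^ (n + m)).coeff (i + j) :=
  lt_of_lt_of_le (mul_pos h1 h2) (aux_pow_coeff_ge F hF n m i j)

open Polynomial in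
theorem aux_mul_pos (F : ℝ[X]) (hF : ∀ i, 0 ≤ F.coeff i) {n i : ℕ}
    (h1 : 0 < (F ^ n).coeff i) (q : ℕ) : 0 < (F ^ (q * n)).coeff (q * i) := by
  induction q with
  | zero => simp
  | succ q ih =>
    rw [Nat.succ_mul, Nat.succ_mul]
    exact aux_pow_pos F hF ih h1

open Polynomial in
theorem aux_coeff_lower (F : ℝ[X]) (hF : ∀ i, 0 ≤ F.coeff i) :
    ∃ κ : ℝ, 0 < κ ∧ κ ≤ 1 ∧ ∀ n i, 0 < (F ^ n).coeff i → κ ^ n ≤ (F ^ n).coeff i := by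
  obtain ⟨κ, h0, h1, h⟩ : ∃ κ : ℝ, 0 < κ ∧ κ ≤ 1 ∧ ∀ i, 0 < F.coeff i → κ ≤ F.coeff i := by
    have : ∀ s : Finset ℕ, ∃ κ : ℝ, 0 < κ ∧ κ ≤ 1 ∧ ∀ i ∈ s, 0 < F.coeff i → κ ≤ F.coeff i := by
      intro s
      induction s using Finset.induction_on with
      | empty => exact ⟨1, by simp⟩
      | insert a s _ ih =>
        obtain ⟨κ, h0, h1, h⟩ := ih
        by_cases ha : 0 < F.coeff a
        · refine ⟨min κ (F.coeff a), lt_min h0 ha, (min_le_left _ _).trans h1, ?_⟩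
          intro i hi hp
          rcases Finset.mem_insert.mp hi with rfl | hi
          · exact min_le_right _ _
          · exact (min_le_left _ _).trans (h i hi hp)
        · refine ⟨κ, h0, h1, ?_⟩
          intro i hi hp
          rcases Finset.mem_insert.mp hi with rfl | hi
          · exact absurd hp ha
          · exact h i hi hp
    obtain ⟨κ, h0, h1, h⟩ := this F.support
    exact ⟨κ, h0, h1, fun i hi => h i (mem_support_iff.mpr hi.ne') hi⟩
  refine ⟨κ, h0, h1, ?_⟩
  intro n
  induction n with
  | zero =>
    intro i hi
    rw [pow_zero, coeff_one] at *
    split_ifs at * <;> simp_all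
  | succ n ih =>
    intro i hi
    rw [pow_succ, coeff_mul] at hi
    obtain ⟨x, hx, hpos⟩ := Finset.exists_lt_of_sum_lt (s := Finset.HasAntidiagonal.antidiagonal i) (f := fun _ => (0:ℝ))
      (by simpa using hi)
    have hxi := Finset.HasAntidiagonal.mem_antidiagonal.mp hx
    have p1 : 0 < (F ^ n).coeff x.1 := by
      rcases (aux_pow_nonneg F hF n x.1).lt_or_eq with h | h
      · exact h
      · rw [← h] at hpos; simp at hpos
    have p2 : 0 < F.coeff x.2 := by
      rcases (hF x.2).lt_or_eq with h | h
      · exact h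
      · rw [← h] at hpos; simp at hpos
    calc κ ^ (n + 1) = κ ^ n * κ := pow_succ _ _
      _ ≤ (F ^ n).coeff x.1 * F.coeff x.2 :=
        mul_le_mul (ih _ p1) (h _ p2) h0.le p1.le
      _ ≤ (F ^ n * F).coeff (x.1 + x.2) :=
        aux_mul_coeff_ge _ _ (aux_pow_nonneg F hF n) hF _ _
      _ = (F ^ (n + 1)).coeff i := by rw [hxi, pow_succ]

open Polynomial in
theorem aux_variance (F : ℝ[X]) (z D V : ℝ)
    (h1 : (X * derivative F).eval z = D * F.eval z)
    (h2 : (X * derivative (X * derivative F)).eval z = (V + D ^ 2) * F.eval z) (n : ℕ) :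
    (X * derivative (F ^ n)).eval z = n * D * (F ^ n).eval z ∧
    (X * derivative (X * derivative (F ^ n))).eval z = (n * V + n ^ 2 * D ^ 2) * (F ^ n).eval z := by
  induction n with
  | zero => simp
  | succ n ih =>
    obtain ⟨i1, i2⟩ := ih
    have e1 : X * derivative (F ^ (n+1)) = (X * derivative (F ^ n)) * F + F ^ n * (X * derivative F) := by
      rw [pow_succ, derivative_mul]; ring
    have e2 : X * derivative (X * derivative (F ^ (n+1))) =
        (X * derivative (X * derivative (F ^ n))) * F +
        2 * ((X * derivative (F ^ n)) * (X * derivative F)) +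
        F ^ n * (X * derivative (X * derivative F)) := by
      rw [e1, derivative_add, derivative_mul (f := X * derivative (F ^ n)),
        derivative_mul (f := F ^ n)]; ring
    constructor
    · rw [e1, eval_add, eval_mul, eval_mul (p := F ^ n), i1, h1, pow_succ, eval_mul]; push_cast; ring
    · rw [e2, eval_add, eval_add, eval_mul, eval_mul (p := F ^ n), eval_mul (p := 2),
        eval_mul (p := X * derivative (F ^ n)), i1, i2, h1, h2, pow_succ F, eval_mul]
      simp only [eval_ofNat]
      push_cast; ring

open Polynomial in
theorem aux_sums (P : ℝ[X]) (z : ℝ) (N : ℕ) (hN : P.natDegree < N) :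
    P.eval z = ∑ j ∈ Finset.range N, P.coeff j * z ^ j ∧
    (X * derivative P).eval z = ∑ j ∈ Finset.range N, (j * P.coeff j) * z ^ j ∧
    (X * derivative (X * derivative P)).eval z =
      ∑ j ∈ Finset.range N, (j ^ 2 * P.coeff j) * z ^ j := by
  have hd : ∀ Q : ℝ[X], Q.natDegree < N → (X * derivative Q).natDegree < N := by
    intro Q hQ
    refine lt_of_le_of_lt ?_ hQ
    rw [natDegree_le_iff_coeff_eq_zero]
    intro j hj
    rw [aux_coeff_theta, coeff_eq_zero_of_natDegree_lt hj, mul_zero]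
  refine ⟨eval_eq_sum_range' hN z, ?_, ?_⟩
  · rw [eval_eq_sum_range' (hd _ hN) z]
    simp only [aux_coeff_theta]
  · rw [eval_eq_sum_range' (hd _ (hd _ hN)) z]
    refine Finset.sum_congr rfl fun j _ => ?_
    rw [aux_coeff_theta, aux_coeff_theta]; ring

open Polynomial in
theorem aux_cheb (F : ℝ[X]) (hF : ∀ i, 0 ≤ F.coeff i) (z D V : ℝ) (hz : 0 < z)
    (hpos : 0 < F.eval z)
    (h1 : (X * derivative F).eval z = D * F.eval z)
    (h2 : (X * derivative (X * derivative F)).eval z = (V + D ^ 2) * F.eval z) (n : ℕ)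
    (w : ℝ) (hw : 0 < w) (hw2 : 2 * (n * V) ≤ w ^ 2) :
    ∃ j : ℕ, |(j : ℝ) - n * D| ≤ w ∧
      F.eval z ^ n / (2 * (F.natDegree * n + 1)) ≤ (F ^ n).coeff j * z ^ j := by
  by_contra! hcon
  obtain ⟨v1, v2⟩ := aux_variance F z D V h1 h2 n
  obtain ⟨s0, s1, s2⟩ := aux_sums (F ^ n) z (n * F.natDegree + 1)
    (Nat.lt_succ_of_le natDegree_pow_le)
  have hE : 0 < (F ^ n).eval z := by rw [eval_pow]; positivity
  set E := (F ^ n).eval z with hEdef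
  have hvar : ∑ j ∈ Finset.range (n * F.natDegree + 1),
      ((j : ℝ) - n * D) ^ 2 * ((F ^ n).coeff j * z ^ j) = n * V * E := by
    have : ∑ j ∈ Finset.range (n * F.natDegree + 1),
      ((j : ℝ) - n * D) ^ 2 * ((F ^ n).coeff j * z ^ j) =
      (X * derivative (X * derivative (F ^ n))).eval z - 2 * (n * D) * (X * derivative (F ^ n)).eval z
        + (n * D) ^ 2 * E := by
      rw [s0, s1, s2, Finset.mul_sum, Finset.mul_sum, ← Finset.sum_sub_distrib,
        ← Finset.sum_add_distrib]
      exact Finset.sum_congr rfl fun j _ => by ring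
    rw [this, v1, v2]; ring
  rw [← eval_pow, ← hEdef] at hcon
  set τ := E / (2 * (F.natDegree * n + 1)) with hτ
  have hτ0 : 0 < τ := by positivity
  have key : E < ∑ j ∈ Finset.range (n * F.natDegree + 1),
      (τ + ((j : ℝ) - n * D) ^ 2 * ((F ^ n).coeff j * z ^ j) / w ^ 2) := by
    rw [s0]
    refine Finset.sum_lt_sum_of_nonempty (by simp) fun j _ => ?_
    have ha : 0 ≤ (F ^ n).coeff j * z ^ j := mul_nonneg (aux_pow_nonneg F hF n j) (by positivity)
    by_cases hj : |(j : ℝ) - n * D| ≤ w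
    · have := hcon j hj
      have : 0 ≤ ((j : ℝ) - n * D) ^ 2 * ((F ^ n).coeff j * z ^ j) / w ^ 2 := by positivity
      linarith
    · push Not at hj
      have hsq : w ^ 2 ≤ ((j : ℝ) - n * D) ^ 2 := by
        rw [← sq_abs ((j : ℝ) - n * D)]; gcongr
      have : (F ^ n).coeff j * z ^ j ≤ ((j : ℝ) - n * D) ^ 2 * ((F ^ n).coeff j * z ^ j) / w ^ 2 := by
        rw [le_div_iff₀ (by positivity), mul_comm]
        gcongr
      linarith
  rw [Finset.sum_add_distrib, ← Finset.sum_div _ _ (w ^ 2), hvar] at key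
  simp only [Finset.sum_const, Finset.card_range, nsmul_eq_mul] at key
  have e1 : ((n * F.natDegree + 1 : ℕ) : ℝ) * τ = E / 2 := by
    rw [hτ]; push_cast; field_simp
  have e2 : n * V * E / w ^ 2 ≤ E / 2 := by
    rw [div_le_iff₀ (by positivity)]
    nlinarith
  linarith

open Polynomial in
theorem aux_cover (F : ℝ[X]) (hF : ∀ i, 0 ≤ F.coeff i) (hF0 : F.coeff 0 = 1) (hd : 0 < F.natDegree) :
    ∃ S : ℕ, ∀ i R : ℕ, S ≤ i → i + F.natDegree * S ≤ F.natDegree * R →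
      (∃ s K, 0 < (F ^ K).coeff s ∧ s ≡ i [MOD F.natDegree]) → 0 < (F ^ R).coeff i := by
  have h00 : ∀ n, 0 < (F ^ n).coeff 0 := by
    intro n; rw [coeff_zero_eq_eval_zero, eval_pow, ← coeff_zero_eq_eval_zero, hF0]; simp
  have : ∀ r : ℕ, ∃ s K : ℕ, (∃ s' K', 0 < (F ^ K').coeff s' ∧ s' ≡ r [MOD F.natDegree]) →
      0 < (F ^ K).coeff s ∧ s ≡ r [MOD F.natDegree] := by
    intro r
    by_cases h : ∃ s' K', 0 < (F ^ K').coeff s' ∧ s' ≡ r [MOD F.natDegree]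
    · obtain ⟨s, K, h⟩ := h
      exact ⟨s, K, fun _ => h⟩
    · exact ⟨0, 0, fun h' => absurd h' h⟩
  choose sf Kf hf using this
  refine ⟨∑ r ∈ Finset.range F.natDegree, (sf r + Kf r), ?_⟩
  intro i R hi hR hex
  set S := ∑ r ∈ Finset.range F.natDegree, (sf r + Kf r)
  have hr : i % F.natDegree < F.natDegree := Nat.mod_lt _ hd
  have hle : sf (i % F.natDegree) + Kf (i % F.natDegree) ≤ S :=
    Finset.single_le_sum (f := fun r => sf r + Kf r) (fun _ _ => Nat.zero_le _)
      (Finset.mem_range.mpr hr)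
  obtain ⟨s', K', p', q'⟩ := hex
  obtain ⟨hp, hmod⟩ := hf (i % F.natDegree) ⟨s', K', p', q'.trans (Nat.mod_modEq _ _).symm⟩
  set s := sf (i % F.natDegree)
  set K := Kf (i % F.natDegree)
  have hmod2 : s ≡ i [MOD F.natDegree] := hmod.trans (Nat.mod_modEq _ _)
  have hsi : s ≤ i := by omega
  obtain ⟨q, hq⟩ := (Nat.modEq_iff_dvd' hsi).mp hmod2
  have hlead : 0 < (F ^ 1).coeff F.natDegree := by
    rw [pow_one]
    refine lt_of_le_of_ne (hF _) (Ne.symm ?_)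
    rw [coeff_natDegree, Ne, leadingCoeff_eq_zero]
    rintro rfl; simp at hd
  have hqR : q + K ≤ R := by
    have : F.natDegree * q + F.natDegree * K ≤ F.natDegree * R := by
      have : F.natDegree * K ≤ F.natDegree * S := Nat.mul_le_mul_left _ (by omega)
      omega
    rw [← Nat.mul_add] at this
    exact Nat.le_of_mul_le_mul_left this hd
  have := aux_pow_pos F hF (aux_pow_pos F hF (aux_mul_pos F hF hlead q) hp) (h00 (R - (q + K)))
  have e1 : q * 1 + K + (R - (q + K)) = R := by omega
  have e2 : q * F.natDegree + s + 0 = i := by rw [mul_comm, ← hq]; omega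
  rwa [e1, e2] at this

open Polynomial in
theorem aux_lower (F : ℝ[X]) (hF : ∀ i, 0 ≤ F.coeff i) (hF0 : F.coeff 0 = 1) (z : ℝ) (hz : 0 < z)
    (D : ℕ) (hD : 0 < D) (hpos : 0 < F.eval z)
    (h1 : (X * derivative F).eval z = D * F.eval z) :
    ∃ (S B : ℕ) (κ : ℝ), 0 < κ ∧ ∀ n w : ℕ, 0 < w → B * n ≤ w ^ 2 → S + w ≤ n →
      0 < (F ^ n).coeff (D * n) →
      F.eval z ^ n * κ ^ (S + w) / (2 * (F.natDegree * n + 1)) ≤ (F ^ n).coeff (D * n) * z ^ (D * n) := by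
  have hDd : D < F.natDegree := by
    by_contra! hle
    obtain ⟨s0, s1, -⟩ := aux_sums F z (F.natDegree + 1) (Nat.lt_succ_self _)
    have hz0 : ∑ j ∈ Finset.range (F.natDegree + 1), ((D : ℝ) - j) * (F.coeff j * z ^ j) = 0 := by
      have : ∑ j ∈ Finset.range (F.natDegree + 1), ((D : ℝ) - j) * (F.coeff j * z ^ j) =
          D * F.eval z - (X * derivative F).eval z := by
        rw [s0, s1, Finset.mul_sum, ← Finset.sum_sub_distrib]
        exact Finset.sum_congr rfl fun j _ => by ring
      rw [this, h1]; ring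
    have hge := Finset.single_le_sum (s := Finset.range (F.natDegree + 1))
      (f := fun j : ℕ => ((D : ℝ) - j) * (F.coeff j * z ^ j)) (fun j hj => by
        have : (j : ℝ) ≤ D := by
          have := Finset.mem_range.mp hj
          exact_mod_cast (by omega : j ≤ D)
        exact mul_nonneg (by linarith) (mul_nonneg (hF j) (by positivity)))
      (Finset.mem_range.mpr (Nat.succ_pos _) : 0 ∈ _)
    rw [hz0] at hge
    simp [hF0] at hge
    omega
  obtain ⟨S0, hS0⟩ := aux_cover F hF hF0 (by omega)
  obtain ⟨κ0, hκ0, hκ1, hκ⟩ := aux_coeff_lower F hF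
  set d := F.natDegree with hd
  set V := (X * derivative (X * derivative F)).eval z / F.eval z - (D : ℝ) ^ 2 with hV
  have h2 : (X * derivative (X * derivative F)).eval z = (V + (D : ℝ) ^ 2) * F.eval z := by
    rw [hV]; field_simp; ring
  have hμ0 : 0 < min 1 z := lt_min one_pos hz
  refine ⟨d * S0 + S0, ⌈2 * |V|⌉₊, κ0 * (min 1 z) ^ d / F.eval z, by positivity, ?_⟩
  intro n w hw hB hSn hp
  set R := d * S0 + S0 + w with hR
  obtain ⟨N, rfl⟩ : ∃ N, n = N + R := ⟨n - R, by omega⟩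
  obtain ⟨j, hj, hjge⟩ := aux_cheb F hF z D V hz hpos h1 h2 N w (by exact_mod_cast hw) (by
    have a1 : 2 * |V| ≤ ⌈2 * |V|⌉₊ := Nat.le_ceil _
    have a2 : (⌈2 * |V|⌉₊ : ℝ) * ((N : ℝ) + R) ≤ (w : ℝ) ^ 2 := by exact_mod_cast hB
    have a3 : V ≤ |V| := le_abs_self _
    have a4 : (0:ℝ) ≤ N := Nat.cast_nonneg _
    have a5 : (0:ℝ) ≤ R := Nat.cast_nonneg _
    have a6 : (N:ℝ) * V ≤ N * |V| := mul_le_mul_of_nonneg_left a3 a4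
    have a7 : 2 * |V| * N ≤ (⌈2 * |V|⌉₊ : ℝ) * N := mul_le_mul_of_nonneg_right a1 a4
    have a8 : 0 ≤ (⌈2 * |V|⌉₊ : ℝ) * R := by positivity
    linarith)
  rw [abs_le] at hj
  have hj1 : j ≤ N * D + w := by
    have : (j : ℝ) ≤ N * D + w := by linarith [hj.2]
    exact_mod_cast this
  have hj2 : N * D ≤ j + w := by
    have : (N * D : ℝ) ≤ j + w := by linarith [hj.1]
    exact_mod_cast this
  have hRD : R ≤ R * D := Nat.le_mul_of_pos_right _ hD
  have hexp : D * (N + R) = N * D + R * D := by ring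
  have hRd : R * D + R ≤ d * R := by
    have : R * (D + 1) ≤ R * d := Nat.mul_le_mul_left _ hDd
    linarith
  obtain ⟨i, hi⟩ : ∃ i, D * (N + R) = j + i := ⟨D * (N + R) - j, by omega⟩
  have hjpos : 0 < (F ^ N).coeff j := by
    have : 0 < (F ^ N).coeff j * z ^ j := lt_of_lt_of_le (by positivity) hjge
    exact pos_of_mul_pos_left this (by positivity)
  have hipos : 0 < (F ^ R).coeff i := by
    refine hS0 i R (by omega) (by omega) ⟨D * (N + R) + (d - 1) * j, (N + R) + (d - 1) * N,
      aux_pow_pos F hF hp (aux_mul_pos F hF hjpos (d - 1)), ?_⟩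
    obtain ⟨e, he⟩ : ∃ e, d = e + 1 := ⟨d - 1, by omega⟩
    have : D * (N + R) + (d - 1) * j = i + d * j := by
      rw [hi, he]; simp only [Nat.add_sub_cancel]; ring
    rw [this]
    simp [Nat.ModEq]
  have hige := hκ R i hipos
  have hid : i ≤ d * R := by omega
  have hzi : (min 1 z) ^ (d * R) ≤ z ^ i :=
    (pow_le_pow_of_le_one hμ0.le (min_le_left _ _) hid).trans
      (pow_le_pow_left₀ hμ0.le (min_le_right _ _) i)
  have hmain := aux_pow_coeff_ge F hF N R j i
  rw [hi]
  calc F.eval z ^ (N + R) * (κ0 * (min 1 z) ^ d / F.eval z) ^ R / (2 * (d * ((N + R : ℕ) : ℝ) + 1))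
      = F.eval z ^ N / (2 * (d * ((N + R : ℕ) : ℝ) + 1)) * (κ0 ^ R * (min 1 z) ^ (d * R)) := by
        rw [div_pow, mul_pow, ← pow_mul, pow_add]
        field_simp
    _ ≤ F.eval z ^ N / (2 * (d * N + 1)) * ((F ^ R).coeff i * z ^ i) := by
        gcongr
        omega
    _ ≤ ((F ^ N).coeff j * z ^ j) * ((F ^ R).coeff i * z ^ i) := by gcongr
    _ = ((F ^ N).coeff j * (F ^ R).coeff i) * z ^ (j + i) := by rw [pow_add]; ring
    _ ≤ _ := by gcongr

open Polynomial in
theorem aux_limit (F : ℝ[X]) (hF : ∀ i, 0 ≤ F.coeff i) (hF0 : F.coeff 0 = 1) (z : ℝ) (hz : 0 < z)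
    (D : ℕ) (hD : 0 < D) (hpos : 0 < F.eval z)
    (h1 : (X * derivative F).eval z = D * F.eval z) (ε : ℝ) (hε : 0 < ε) :
    ∀ᶠ n : ℕ in Filter.atTop, 0 < (F ^ n).coeff (D * n) →
      |Real.log ((F ^ n).coeff (D * n)) / n - (Real.log (F.eval z) - D * Real.log z)| < ε := by
  obtain ⟨S, B, κ, hκ, hlow⟩ := aux_lower F hF hF0 z hz D hD hpos h1
  set C : ℝ := (S + √B + 1) * |Real.log κ| + 2 * √(2 * (F.natDegree + 1)) with hC
  have hsq : Filter.Tendsto (fun n : ℕ => √(n : ℝ)) Filter.atTop Filter.atTop :=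
    Real.tendsto_sqrt_atTop.comp tendsto_natCast_atTop_atTop
  filter_upwards [Filter.eventually_ge_atTop 1, hsq.eventually_ge_atTop (S + √B + 1),
    hsq.eventually_gt_atTop (C / ε)] with n hn hn1 hn2 hp
  have hn0 : (0:ℝ) < n := by exact_mod_cast hn
  have hs1 : 1 ≤ √(n:ℝ) := by rw [Real.one_le_sqrt]; exact_mod_cast hn
  have hss : √(n:ℝ) * √(n:ℝ) = n := Real.mul_self_sqrt hn0.le
  set w := Nat.sqrt (B * n) + 1 with hw
  have hwle : (w : ℝ) ≤ √B * √n + 1 := by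
    rw [hw, ← Real.sqrt_mul (by positivity)]; push_cast
    have := Real.nat_sqrt_le_real_sqrt (a := B * n)
    push_cast at this; linarith
  have hSw : (S + w : ℝ) ≤ (S + √B + 1) * √n := by
    have : (S:ℝ) ≤ S * √n := le_mul_of_one_le_right (by positivity) hs1
    nlinarith
  have hL := hlow n w (by omega) (by
      have := Nat.lt_succ_sqrt' (B * n)
      exact this.le) (by
      have : (S + w : ℝ) ≤ n := by
        refine hSw.trans ?_
        nth_rewrite 2 [← hss]
        gcongr
      exact_mod_cast this) hp
  have hU : (F ^ n).coeff (D * n) * z ^ (D * n) ≤ F.eval z ^ n := by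
    rw [← eval_pow]
    rw [(aux_sums (F ^ n) z ((F ^ n).natDegree + D * n + 1) (by omega)).1]
    exact Finset.single_le_sum (f := fun j => (F ^ n).coeff j * z ^ j)
      (fun j _ => mul_nonneg (aux_pow_nonneg F hF n j) (by positivity))
      (Finset.mem_range.mpr (by omega))
  have hU' := Real.log_le_log (by positivity) hU
  have hL' := Real.log_le_log (by positivity) hL
  rw [Real.log_mul hp.ne' (by positivity), Real.log_pow, Real.log_pow] at hU'
  rw [Real.log_mul hp.ne' (by positivity), Real.log_pow, Real.log_div (by positivity) (by positivity),
    Real.log_mul (by positivity) (by positivity), Real.log_pow, Real.log_pow] at hL'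
  push_cast at hU' hL'
  have hlog : Real.log (2 * (F.natDegree * n + 1)) ≤ 2 * √(2 * (F.natDegree + 1)) * √n := by
    have a1 : Real.log (2 * (F.natDegree * (n:ℝ) + 1)) = 2 * Real.log (√(2 * (F.natDegree * (n:ℝ) + 1))) := by
      rw [Real.log_sqrt (by positivity)]; ring
    have a2 := Real.log_le_sub_one_of_pos (x := √(2 * (F.natDegree * (n:ℝ) + 1))) (by positivity)
    have a3 : √(2 * (F.natDegree * (n:ℝ) + 1)) ≤ √(2 * (F.natDegree + 1)) * √n := by
      rw [← Real.sqrt_mul (by positivity)]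
      apply Real.sqrt_le_sqrt
      have : (1:ℝ) ≤ n := by exact_mod_cast hn
      nlinarith
    linarith
  have hκl : -((S + √B + 1) * √n * |Real.log κ|) ≤ (S + w) * Real.log κ := by
    have b1 : -|Real.log κ| ≤ Real.log κ := neg_abs_le _
    have b2 : (S + w : ℝ) * |Real.log κ| ≤ (S + √B + 1) * √n * |Real.log κ| := by gcongr
    have b3 : (S + w : ℝ) * (-|Real.log κ|) ≤ (S + w) * Real.log κ := by gcongr
    linarith
  have hCn : C * √n < ε * n := by
    rw [div_lt_iff₀ hε] at hn2
    calc C * √n < (√n * ε) * √n := by gcongr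
      _ = ε * n := by rw [← hss]; simp only [hss]; nlinarith
  have hCe : C * √n = (S + √B + 1) * √n * |Real.log κ| + 2 * √(2 * (F.natDegree + 1)) * √n := by
    rw [hC]; ring
  have hrew : Real.log ((F ^ n).coeff (D * n)) / n - (Real.log (F.eval z) - D * Real.log z) =
      (Real.log ((F ^ n).coeff (D * n)) + D * n * Real.log z - n * Real.log (F.eval z)) / n := by
    field_simp; ring
  rw [hrew, abs_div, abs_of_pos hn0, div_lt_iff₀ hn0, abs_lt]
  constructor
  · linarith
  · have : 0 < ε * n := by positivity
    linarith

open Polynomial in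
theorem aux_prod {ι : Type*} (P : ι → ℝ[X]) (g : ι → ℕ) (z : ℝ) (hP : ∀ t i, 0 ≤ (P t).coeff i)
    (hP0 : ∀ t, (P t).coeff 0 = 1) (hpos : ∀ t, 0 < (P t).eval z) (s : Finset ι) :
    (∀ i, 0 ≤ (∏ t ∈ s, P t ^ g t).coeff i) ∧ (∏ t ∈ s, P t ^ g t).coeff 0 = 1 ∧
    (X * derivative (∏ t ∈ s, P t ^ g t)).eval z =
      (∑ t ∈ s, g t * (z * (derivative (P t)).eval z / (P t).eval z)) * (∏ t ∈ s, P t ^ g t).eval z := by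
  classical
  induction s using Finset.induction_on with
  | empty =>
    refine ⟨?_, by simp, by simp⟩
    intro i; rw [Finset.prod_empty, coeff_one]; split_ifs <;> norm_num
  | insert a s ha ih =>
    obtain ⟨i1, i2, i3⟩ := ih
    rw [Finset.prod_insert ha, Finset.sum_insert ha]
    refine ⟨?_, ?_, ?_⟩
    · intro i
      rw [coeff_mul]
      exact Finset.sum_nonneg fun x _ => mul_nonneg (aux_pow_nonneg _ (hP a) _ _) (i1 _)
    · rw [mul_coeff_zero, i2, mul_one, coeff_zero_eq_eval_zero, eval_pow, ← coeff_zero_eq_eval_zero,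
        hP0, one_pow]
    · have ne := (hpos a).ne'
      have hv := (aux_variance (P a) z (z * (derivative (P a)).eval z / (P a).eval z)
        ((X * derivative (X * derivative (P a))).eval z / (P a).eval z -
          (z * (derivative (P a)).eval z / (P a).eval z) ^ 2)
        (by rw [eval_mul, eval_X]; field_simp) (by rw [sub_add_cancel]; field_simp) (g a)).1
      have e : X * derivative (P a ^ g a * ∏ t ∈ s, P t ^ g t) =
          (X * derivative (P a ^ g a)) * (∏ t ∈ s, P t ^ g t) +
          P a ^ g a * (X * derivative (∏ t ∈ s, P t ^ g t)) := by
        rw [derivative_mul]; ring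
      rw [e, eval_add, eval_mul, hv, eval_mul (p := P a ^ g a), i3, eval_mul (p := P a ^ g a)]
      ring

theorem aux_den (q : ℚ) (m : ℕ) : (q * (m : ℚ)).den = 1 ↔ q.den ∣ m := by
  constructor
  · intro h
    have h1 : ((q * m).num : ℚ) = q * m := Rat.coe_int_num_of_den_eq_one h
    have h2 : ((q.num * m : ℤ) : ℚ) = ((q * m).num * q.den : ℤ) := by
      push_cast; rw [h1]
      rw [← Rat.mul_den_eq_num]; ring
    have h3 : q.num * m = (q * m).num * q.den := by exact_mod_cast h2
    have h4 : (q.den : ℤ) ∣ q.num * m := ⟨_, by rw [h3, mul_comm]⟩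
    have h5 : q.den ∣ q.num.natAbs * m := by
      have := Int.natAbs_dvd_natAbs.mpr h4
      simpa [Int.natAbs_mul] using this
    exact (q.reduced.symm).dvd_of_dvd_mul_left h5
  · rintro ⟨n, rfl⟩
    have : q * ((q.den * n : ℕ) : ℚ) = ((q.num * n : ℤ) : ℚ) := by
      push_cast
      rw [← mul_assoc, Rat.mul_den_eq_num]
    rw [this]; rfl

theorem aux_num (q : ℚ) (hq : 0 < q) (m : ℕ) (h : (q * (m : ℚ)).den = 1) :
    (((q * (m : ℚ)).num.toNat : ℕ) : ℚ) = q * m := by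
  have h1 : ((q * m).num : ℚ) = q * m := Rat.coe_int_num_of_den_eq_one h
  have h2 : 0 ≤ (q * m).num := Rat.num_nonneg.mpr (by positivity)
  rw [← h1]
  exact_mod_cast Int.toNat_of_nonneg h2

theorem aux_polyA (c d : ℕ) (A : ℕ → ℝ) (hc : 1 ≤ c) (hAc : 0 < A c)
    (hA : ∀ u, c < u → u ≤ d → 0 ≤ A u) :
    (∀ i, 0 ≤ (polyA c d A).coeff i) ∧ (polyA c d A).coeff 0 = 1 := by
  have hco : ∀ i, (polyA c d A).coeff i = (if i = 0 then 1 else 0) +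
      ∑ u ∈ Finset.Icc c d, (if i = u then A u else 0) := by
    intro i
    simp [polyA, Polynomial.coeff_one, Polynomial.coeff_X_pow]
  constructor
  · intro i
    rw [hco]
    refine add_nonneg (by split_ifs <;> norm_num) (Finset.sum_nonneg fun u hu => ?_)
    rw [Finset.mem_Icc] at hu
    split_ifs
    · rcases hu.1.eq_or_lt with rfl | h
      · exact hAc.le
      · exact hA u h hu.2
    · exact le_rfl
  · rw [hco]
    simp
    intros; omega

theorem aux_eval_pos (P : Polynomial ℝ) (hP : ∀ i, 0 ≤ P.coeff i) (h0 : P.coeff 0 = 1) (z : ℝ)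
    (hz : 0 < z) : 0 < P.eval z := by
  rw [Polynomial.eval_eq_sum_range]
  refine Finset.sum_pos' (fun i _ => mul_nonneg (hP i) (by positivity))
    ⟨0, Finset.mem_range.mpr (Nat.succ_pos _), by simp [h0]⟩

/-- Exponential growth rate of `Coeff[∏_t (A_t(x))^{γ_t m}, x^{δ m}]`:
it converges to `∑_t γ_t log A_t(z₀) - δ log z₀`, where `z₀` is the unique
positive solution of `∑_t γ_t z A_t'(z)/A_t(z) = δ`. -/
theorem stmt3 (k : ℕ) (hk : 1 ≤ k) (c d : Fin k → ℕ)
    (hc : ∀ t, 1 ≤ c t) (hcd : ∀ t, c t ≤ d t)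
    (A : Fin k → ℕ → ℝ)
    (hAc : ∀ t, 0 < A t (c t))
    (hA : ∀ t u, c t < u → u ≤ d t → 0 ≤ A t u)
    (γ : Fin k → ℚ) (hγ : ∀ t, 0 < γ t)
    (δ : ℚ) (hδ0 : 0 < δ) (hδ : (δ : ℝ) < ∑ t, (γ t : ℝ) * (d t : ℝ))
    (z₀ : ℝ) (hz₀ : 0 < z₀)
    (hz₀eq : ∑ t, (γ t : ℝ) *
        (z₀ * (Polynomial.derivative (polyA (c t) (d t) (A t))).eval z₀
          / (polyA (c t) (d t) (A t)).eval z₀) = (δ : ℝ)) :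
    Filter.Tendsto
      (fun m : ℕ => (1 / (m : ℝ)) *
        Real.log ((∏ t, (polyA (c t) (d t) (A t)) ^ ((γ t * (m : ℚ)).num.toNat)).coeff
          ((δ * (m : ℚ)).num.toNat)))
      (Filter.atTop ⊓ Filter.principal
        {m : ℕ | 0 < m ∧ (∀ t, (γ t * (m : ℚ)).den = 1) ∧ (δ * (m : ℚ)).den = 1 ∧
          0 < (∏ t, (polyA (c t) (d t) (A t)) ^ ((γ t * (m : ℚ)).num.toNat)).coeff
            ((δ * (m : ℚ)).num.toNat)})
      (nhds (∑ t, (γ t : ℝ) * Real.log ((polyA (c t) (d t) (A t)).eval z₀)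
        - (δ : ℝ) * Real.log z₀)) := by
  classical
  set P : Fin k → Polynomial ℝ := fun t => polyA (c t) (d t) (A t) with hPdef
  have hP : ∀ t i, 0 ≤ (P t).coeff i := fun t => (aux_polyA _ _ _ (hc t) (hAc t) (hA t)).1
  have hP0 : ∀ t, (P t).coeff 0 = 1 := fun t => (aux_polyA _ _ _ (hc t) (hAc t) (hA t)).2
  have hPpos : ∀ t, 0 < (P t).eval z₀ := fun t => aux_eval_pos _ (hP t) (hP0 t) z₀ hz₀
  set N : ℕ := Nat.lcm δ.den (Finset.univ.lcm fun t => (γ t).den) with hN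
  have hN0 : 0 < N := by
    apply Nat.pos_of_ne_zero
    rw [hN]
    refine Nat.lcm_ne_zero δ.den_nz ?_
    rw [Ne, Finset.lcm_eq_zero_iff]
    rintro ⟨t, -, ht⟩
    exact (γ t).den_nz ht
  have hNδ : (δ * (N : ℚ)).den = 1 := (aux_den _ _).mpr (Nat.dvd_lcm_left _ _)
  have hNγ : ∀ t, (γ t * (N : ℚ)).den = 1 := fun t => (aux_den _ _).mpr
    ((Finset.dvd_lcm (f := fun t => (γ t).den) (Finset.mem_univ t)).trans (Nat.dvd_lcm_right _ _))
  set g : Fin k → ℕ := fun t => (γ t * (N : ℚ)).num.toNat with hg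
  set D : ℕ := (δ * (N : ℚ)).num.toNat with hDdef
  have hgq : ∀ t, (g t : ℚ) = γ t * N := fun t => aux_num _ (hγ t) N (hNγ t)
  have hDq : (D : ℚ) = δ * N := aux_num _ hδ0 N hNδ
  have hgr : ∀ t, (g t : ℝ) = γ t * N := fun t => by exact_mod_cast congrArg (fun q : ℚ => (q : ℝ)) (hgq t)
  have hDr : (D : ℝ) = δ * N := by exact_mod_cast congrArg (fun q : ℚ => (q : ℝ)) hDq
  have hNr : (0 : ℝ) < N := by exact_mod_cast hN0
  have hD0 : 0 < D := by
    have : (0 : ℚ) < D := by rw [hDq]; have : (0:ℚ) < N := by exact_mod_cast hN0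
                             positivity
    exact_mod_cast this
  obtain ⟨hF, hF0, hF1⟩ := aux_prod P g z₀ hP hP0 hPpos Finset.univ
  set F : Polynomial ℝ := ∏ t, P t ^ g t with hFdef
  have hFpos : 0 < F.eval z₀ := aux_eval_pos F hF hF0 z₀ hz₀
  have hmean : ∑ t, (g t : ℝ) * (z₀ * (Polynomial.derivative (P t)).eval z₀ / (P t).eval z₀) = D := by
    rw [hDr, ← hz₀eq, Finset.sum_mul]
    refine Finset.sum_congr rfl fun t _ => ?_
    rw [hgr t]; ring
  rw [hmean] at hF1
  have hlogF : Real.log (F.eval z₀) = N * ∑ t, (γ t : ℝ) * Real.log ((P t).eval z₀) := by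
    rw [hFdef, Polynomial.eval_prod, Real.log_prod (fun t _ => by
      rw [Polynomial.eval_pow]; exact (pow_pos (hPpos t) _).ne'), Finset.mul_sum]
    refine Finset.sum_congr rfl fun t _ => ?_
    rw [Polynomial.eval_pow, Real.log_pow, hgr t]; ring
  rw [Metric.tendsto_nhds]
  intro ε hε
  have hev := aux_limit F hF hF0 z₀ hz₀ D hD0 hFpos hF1 (N * ε) (by positivity)
  obtain ⟨n0, hn0⟩ := Filter.eventually_atTop.mp hev
  rw [Filter.eventually_inf_principal]
  filter_upwards [Filter.eventually_ge_atTop (N * n0)] with m hm hmem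
  obtain ⟨hm0, hmγ, hmδ, hmpos⟩ := hmem
  have hdvd : N ∣ m := Nat.lcm_dvd ((aux_den _ _).mp hmδ)
    (Finset.lcm_dvd fun t _ => (aux_den _ _).mp (hmγ t))
  obtain ⟨n, rfl⟩ := hdvd
  have hn : n0 ≤ n := Nat.le_of_mul_le_mul_left hm hN0
  have hnpos : 0 < n := Nat.pos_of_mul_pos_left hm0
  have eγ : ∀ t, (γ t * ((N * n : ℕ) : ℚ)).num.toNat = g t * n := fun t => by
    have := aux_num _ (hγ t) _ (hmγ t)
    have h2 : (((γ t * ((N * n : ℕ) : ℚ)).num.toNat : ℕ) : ℚ) = ((g t * n : ℕ) : ℚ) := by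
      rw [this]; push_cast; rw [hgq t]; ring
    exact_mod_cast h2
  have eδ : (δ * ((N * n : ℕ) : ℚ)).num.toNat = D * n := by
    have := aux_num _ hδ0 _ hmδ
    have h2 : (((δ * ((N * n : ℕ) : ℚ)).num.toNat : ℕ) : ℚ) = ((D * n : ℕ) : ℚ) := by
      rw [this]; push_cast; rw [hDq]; ring
    exact_mod_cast h2
  have eF : ∏ t, polyA (c t) (d t) (A t) ^ (γ t * ((N * n : ℕ) : ℚ)).num.toNat = F ^ n := by
    rw [hFdef, ← Finset.prod_pow]
    refine Finset.prod_congr rfl fun t _ => ?_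
    rw [eγ t, pow_mul]
  rw [eF, eδ] at hmpos
  rw [eF, eδ]
  have hfin := hn0 n hn hmpos
  have hnr : (0 : ℝ) < n := by exact_mod_cast hnpos
  rw [Real.dist_eq]
  have hrew : 1 / ((N * n : ℕ) : ℝ) * Real.log ((F ^ n).coeff (D * n)) -
      (∑ t, (γ t : ℝ) * Real.log ((P t).eval z₀) - (δ : ℝ) * Real.log z₀) =
      (Real.log ((F ^ n).coeff (D * n)) / n - (Real.log (F.eval z₀) - D * Real.log z₀)) / N := by
    rw [hlogF, hDr]; push_cast; field_simp
  rw [hrew, abs_div, abs_of_pos hNr, div_lt_iff₀ hNr]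
  linarith
end

section
/- Let k \ge 1 and, for each t = 1, ..., k, let A_t(x) = 1 + \sum_{u=c_t}^{d_t} A_{t,u} x^u, where 1 \le c_t \le d_t, be a real polynomial satisfying A_{t,c_t} > 0 and A_{t,u} \ge 0 for all c_t < u \le d_t, let \gamma_1, ..., \gamma_k > 0, and let 0 < \delta < \sum_{t=1}^k \gamma_t d_t. For \epsilon = (\epsilon_1, ..., \epsilon_k) with 0 < \epsilon_t < \gamma_t d_t for all t, let z_t(\epsilon_t) denote the unique positive real solution of \gamma_t \, z A_t'(z)/A_t(z) = \epsilon_t, and define W(\epsilon) = \sum_{t=1}^{k} ( \gamma_t \log A_t(z_t(\epsilon_t)) - \epsilon_t \log z_t(\epsilon_t) ). Then the supremum of W(\epsilon) over all such \epsilon satisfying \sum_{t=1}^k \epsilon_t = \delta equals \sum_{t=1}^{k} \gamma_t \log A_t(z_0) - \delta \log z_0, where z_0 is the unique positive real solution of \sum_{t=1}^{k} \gamma_t \, z A_t'(z)/A_t(z) = \delta; moreover, this supremum is attained at the point \epsilon with \epsilon_t = \gamma_t z_0 A_t'(z_0)/A_t(z_0) for all t, i.e., where z_t(\epsilon_t)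 = z_0 for every t. -/
theorem polyA_eval (c d : ℕ) (A : ℕ → ℝ) (x : ℝ) :
    (polyA c d A).eval x = 1 + ∑ u ∈ Finset.Icc c d, A u * x ^ u := by
  simp [polyA, Polynomial.eval_finset_sum]

theorem polyA_deriv (c d : ℕ) (A : ℕ → ℝ) (x : ℝ) :
    x * (Polynomial.derivative (polyA c d A)).eval x
      = ∑ u ∈ Finset.Icc c d, (u : ℝ) * (A u * x ^ u) := by
  simp only [polyA, Polynomial.derivative_add, Polynomial.derivative_one, zero_add,
    Polynomial.derivative_sum, Polynomial.eval_finset_sum, Finset.mul_sum]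
  refine Finset.sum_congr rfl fun u _ => ?_
  rcases u with _ | u
  · simp
  · simp [Polynomial.derivative_X_pow]
    ring

theorem polyA_bounds (c d : ℕ) (A : ℕ → ℝ) (hc : 1 ≤ c) (hcd : c ≤ d) (hAc : 0 < A c)
    (hA : ∀ u, c < u → u ≤ d → 0 ≤ A u) (x : ℝ) (hx : 0 < x) :
    0 < (polyA c d A).eval x ∧
    0 < x * (Polynomial.derivative (polyA c d A)).eval x / (polyA c d A).eval x ∧
    x * (Polynomial.derivative (polyA c d A)).eval x / (polyA c d A).eval x < d := by
  have hn : ∀ u ∈ Finset.Icc c d, 0 ≤ A u * x ^ u := by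
    intro u hu
    rw [Finset.mem_Icc] at hu
    rcases hu.1.eq_or_lt with h | h
    · subst h; positivity
    · have := hA u h hu.2
      positivity
  have hs := Finset.sum_nonneg hn
  have hpos : 0 < (polyA c d A).eval x := by rw [polyA_eval]; linarith
  have hd : (0:ℝ) < d := by exact_mod_cast (by omega : 0 < d)
  refine ⟨hpos, ?_, ?_⟩
  · refine div_pos ?_ hpos
    rw [polyA_deriv]
    refine Finset.sum_pos' (fun u hu => mul_nonneg (Nat.cast_nonneg u) (hn u hu))
      ⟨c, Finset.mem_Icc.2 ⟨le_rfl, hcd⟩, ?_⟩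
    have : (0:ℝ) < c := by exact_mod_cast hc
    positivity
  · rw [div_lt_iff₀ hpos, polyA_deriv, polyA_eval, mul_add, Finset.mul_sum]
    have : ∑ u ∈ Finset.Icc c d, (u : ℝ) * (A u * x ^ u)
        ≤ ∑ u ∈ Finset.Icc c d, (d : ℝ) * (A u * x ^ u) := by
      refine Finset.sum_le_sum fun u hu => mul_le_mul_of_nonneg_right ?_ (hn u hu)
      exact_mod_cast (Finset.mem_Icc.1 hu).2
    linarith

theorem polyA_key (c d : ℕ) (A : ℕ → ℝ) (hc : 1 ≤ c) (hcd : c ≤ d) (hAc : 0 < A c)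
    (hA : ∀ u, c < u → u ≤ d → 0 ≤ A u) (x y p : ℝ) (hx : 0 < x) (hy : 0 < y)
    (hp : x * (Polynomial.derivative (polyA c d A)).eval x / (polyA c d A).eval x = p) :
    Real.log ((polyA c d A).eval x) - p * Real.log x
      ≤ Real.log ((polyA c d A).eval y) - p * Real.log y := by
  have hn : ∀ u ∈ Finset.Icc c d, 0 ≤ A u * x ^ u := by
    intro u hu
    rw [Finset.mem_Icc] at hu
    rcases hu.1.eq_or_lt with h | h
    · subst h; positivity
    · have := hA u h hu.2
      positivity
  have hpx := (polyA_bounds c d A hc hcd hAc hA x hx).1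
  rw [div_eq_iff hpx.ne', polyA_deriv] at hp
  obtain ⟨r, hr⟩ : ∃ r, r = Real.log y - Real.log x := ⟨_, rfl⟩
  have hyr : y = x * Real.exp r := by
    rw [hr, Real.exp_sub, Real.exp_log hx, Real.exp_log hy]; field_simp
  have hE : ∀ s : ℝ, Real.exp (p * r) * (1 + s * r - p * r) ≤ Real.exp (s * r) := by
    intro s
    have h1 := Real.add_one_le_exp (s * r - p * r)
    have h2 : Real.exp (s * r) = Real.exp (p * r) * Real.exp (s * r - p * r) := by
      rw [← Real.exp_add]; ring_nf
    rw [h2]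
    exact mul_le_mul_of_nonneg_left (by linarith) (Real.exp_pos _).le
  have hmain : Real.exp (p * r) * (polyA c d A).eval x ≤ (polyA c d A).eval y := by
    have h3 : ∑ u ∈ Finset.Icc c d, Real.exp (p * r) * (1 + (u:ℝ) * r - p * r) * (A u * x ^ u)
        ≤ ∑ u ∈ Finset.Icc c d, A u * y ^ u := by
      refine Finset.sum_le_sum fun u hu => ?_
      have : A u * y ^ u = Real.exp (u * r) * (A u * x ^ u) := by
        rw [hyr, mul_pow, ← Real.exp_nat_mul]; ring
      rw [this]
      exact mul_le_mul_of_nonneg_right (hE u) (hn u hu)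
    have h4 : ∑ u ∈ Finset.Icc c d, Real.exp (p * r) * (1 + (u:ℝ) * r - p * r) * (A u * x ^ u)
        = Real.exp (p * r) * (1 - p * r) * (∑ u ∈ Finset.Icc c d, A u * x ^ u)
          + Real.exp (p * r) * r * ∑ u ∈ Finset.Icc c d, (u : ℝ) * (A u * x ^ u) := by
      rw [Finset.mul_sum, Finset.mul_sum, ← Finset.sum_add_distrib]
      exact Finset.sum_congr rfl fun u _ => by ring
    have h0 := hE 0
    rw [zero_mul, Real.exp_zero] at h0
    rw [h4, hp] at h3
    rw [polyA_eval] at h3 ⊢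
    rw [polyA_eval]
    nlinarith
  have hl := Real.log_le_log (by positivity) hmain
  rw [Real.log_mul (Real.exp_pos _).ne' hpx.ne', Real.log_exp, hr] at hl
  linarith

/-- The constrained maximization of
`W(ε) = ∑_t (γ_t log A_t(z_t(ε_t)) - ε_t log z_t(ε_t))` over the simplex slice
`∑_t ε_t = δ`, `0 < ε_t < γ_t d_t`, where `z_t(ε_t)` is the unique positive
solution of `γ_t z A_t'(z)/A_t(z) = ε_t`: the supremum equals
`∑_t γ_t log A_t(z₀) - δ log z₀`, with `z₀` the unique positive solution of
`∑_t γ_t z A_t'(z)/A_t(z) = δ`, and is attained where `z_t(ε_t) = z₀` for all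
`t`, i.e. at `ε_t = γ_t z₀ A_t'(z₀)/A_t(z₀)`. -/
theorem stmt4 (k : ℕ) (hk : 1 ≤ k) (c d : Fin k → ℕ)
    (hc : ∀ t, 1 ≤ c t) (hcd : ∀ t, c t ≤ d t)
    (A : Fin k → ℕ → ℝ)
    (hAc : ∀ t, 0 < A t (c t))
    (hA : ∀ t u, c t < u → u ≤ d t → 0 ≤ A t u)
    (γ : Fin k → ℝ) (hγ : ∀ t, 0 < γ t)
    (δ : ℝ) (hδ0 : 0 < δ) (hδ : δ < ∑ t, γ t * (d t : ℝ))
    (z₀ : ℝ) (hz₀ : 0 < z₀)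
    (hz₀eq : ∑ t, γ t *
        (z₀ * (Polynomial.derivative (polyA (c t) (d t) (A t))).eval z₀
          / (polyA (c t) (d t) (A t)).eval z₀) = δ) :
    IsGreatest
      { w : ℝ | ∃ ε zt : Fin k → ℝ,
          (∀ t, 0 < ε t ∧ ε t < γ t * (d t : ℝ)) ∧ (∑ t, ε t = δ) ∧
          (∀ t, 0 < zt t ∧
            γ t * (zt t * (Polynomial.derivative (polyA (c t) (d t) (A t))).eval (zt t)
              / (polyA (c t) (d t) (A t)).eval (zt t)) = ε t) ∧
          w = ∑ t, (γ t * Real.log ((polyA (c t) (d t) (A t)).eval (zt t))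
            - ε t * Real.log (zt t)) }
      (∑ t, γ t * Real.log ((polyA (c t) (d t) (A t)).eval z₀) - δ * Real.log z₀)
    ∧
    -- the maximum is attained at the point `ε` with
    -- `ε_t = γ_t z₀ A_t'(z₀)/A_t(z₀)`, i.e. with `z_t(ε_t) = z₀` for every `t`:
    (∀ t, 0 < γ t * (z₀ * (Polynomial.derivative (polyA (c t) (d t) (A t))).eval z₀
        / (polyA (c t) (d t) (A t)).eval z₀) ∧
      γ t * (z₀ * (Polynomial.derivative (polyA (c t) (d t) (A t))).eval z₀
        / (polyA (c t) (d t) (A t)).eval z₀) < γ t * (d t : ℝ)) ∧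
    ∑ t, (γ t * Real.log ((polyA (c t) (d t) (A t)).eval z₀)
        - (γ t * (z₀ * (Polynomial.derivative (polyA (c t) (d t) (A t))).eval z₀
          / (polyA (c t) (d t) (A t)).eval z₀)) * Real.log z₀)
      = ∑ t, γ t * Real.log ((polyA (c t) (d t) (A t)).eval z₀) - δ * Real.log z₀ := by
  have hb := fun t => polyA_bounds (c t) (d t) (A t) (hc t) (hcd t) (hAc t) (hA t) z₀ hz₀
  have hbd : ∀ t, 0 < γ t * (z₀ * (Polynomial.derivative (polyA (c t) (d t) (A t))).eval z₀
        / (polyA (c t) (d t) (A t)).eval z₀) ∧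
      γ t * (z₀ * (Polynomial.derivative (polyA (c t) (d t) (A t))).eval z₀
        / (polyA (c t) (d t) (A t)).eval z₀) < γ t * (d t : ℝ) := fun t =>
    ⟨mul_pos (hγ t) (hb t).2.1, mul_lt_mul_of_pos_left (hb t).2.2 (hγ t)⟩
  have hval : ∑ t, (γ t * Real.log ((polyA (c t) (d t) (A t)).eval z₀)
        - (γ t * (z₀ * (Polynomial.derivative (polyA (c t) (d t) (A t))).eval z₀
          / (polyA (c t) (d t) (A t)).eval z₀)) * Real.log z₀)
      = ∑ t, γ t * Real.log ((polyA (c t) (d t) (A t)).eval z₀) - δ * Real.log z₀ := by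
    rw [Finset.sum_sub_distrib, ← Finset.sum_mul, hz₀eq]
  refine ⟨⟨⟨_, fun _ => z₀, hbd, hz₀eq, fun t => ⟨hz₀, rfl⟩, hval.symm⟩, ?_⟩, hbd, hval⟩
  rintro w ⟨ε, zt, -, hsum, hz, rfl⟩
  rw [← hsum, Finset.sum_mul, ← Finset.sum_sub_distrib]
  refine Finset.sum_le_sum fun t _ => ?_
  obtain ⟨hzt, he⟩ := hz t
  have h := polyA_key (c t) (d t) (A t) (hc t) (hcd t) (hAc t) (hA t) (zt t) z₀ _ hzt hz₀ rfl
  have h' := mul_le_mul_of_nonneg_left h (hγ t).le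
  rw [mul_sub, mul_sub, ← mul_assoc, ← mul_assoc, he] at h'
  exact h'
end
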